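/- Let k be an algebraically closed field. The plane Cremona group Bir(ℙ²_k) has no non-trivial finite-dimensional linear representation over any field: for every field K and every integer n ≥ 1, every group homomorphism from Aut_k(k(x,y)) to GL(n,K) is trivial. In particular Bir(ℙ²_k) has no faithful finite-dimensional linear representation. -/

import Mathlib

set_option autoImplicit false

noncomputable section

universe u v

/-- The plane Cremona group `Bir(ℙ²_k) = Aut_k(k(x,y))` over a field `k`. -/
abbrev CremonaK (k : Type u) [Field k] : Type u :=
  FractionRing (MvPolynomial (Fin 2) k) ≃ₐ[k] FractionRing (MvPolynomial (Fin 2) k)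

/-- The extension of a derivation to the field of fractions. -/
def Derivation.extendFractionRing {k A F : Type*} [Field k] [CommRing A] [Field F]
    [Algebra k A] [Algebra k F] [Algebra A F] [IsScalarTower k A F] [IsFractionRing A F]
    (d : Derivation k A F) : Derivation k F F :=
  have : Algebra.FormallyEtale A F :=
    Algebra.FormallyEtale.of_isLocalization (nonZeroDivisors A)
  ((LinearMap.liftBaseChange F d.liftKaehlerDifferential) ∘ₗ
    (KaehlerDifferential.tensorKaehlerEquivOfFormallyEtale k A F).symm.toLinearMap).compDer
    (KaehlerDifferential.D k F)

theorem Derivation.extendFractionRing_algebraMap {k A F : Type*} [Field k] [CommRing A] [Field F]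
    [Algebra k A] [Algebra k F] [Algebra A F] [IsScalarTower k A F] [IsFractionRing A F]
    (d : Derivation k A F) (a : A) : d.extendFractionRing (algebraMap A F a) = d a := by
  have : Algebra.FormallyEtale A F :=
    Algebra.FormallyEtale.of_isLocalization (nonZeroDivisors A)
  simp [Derivation.extendFractionRing,
    KaehlerDifferential.tensorKaehlerEquivOfFormallyEtale_symm_D_algebraMap]

/-- A bound for a derivation with respect to a valuation extends from a ring to its fractions. -/
theorem Valuation.derivation_le_of_isFractionRing {k A F : Type*} [Field k] [CommRing A] [IsDomain A]
    [Field F] [Algebra k F] [Algebra A F] [IsFractionRing A F]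
    (ν : Valuation F (WithZero (Multiplicative ℤ))) (D : Derivation k F F)
    (c : WithZero (Multiplicative ℤ))
    (h : ∀ a : A, ν (D (algebraMap A F a)) ≤ c * ν (algebraMap A F a)) (x : F) :
    ν (D x) ≤ c * ν x := by
  obtain ⟨a, b, hb, rfl⟩ := IsFractionRing.div_surjective (A := A) x
  have hb0 : algebraMap A F b ≠ 0 := by
    simpa using nonZeroDivisors.ne_zero hb
  have hν : ν (algebraMap A F b) ≠ 0 := by simpa using hb0
  rw [D.leibniz_div, smul_eq_mul, map_mul, map_pow, map_inv₀, map_div₀, smul_eq_mul, smul_eq_mul]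
  have h1 : ν (algebraMap A F b * D (algebraMap A F a) - algebraMap A F a * D (algebraMap A F b))
      ≤ c * ν (algebraMap A F a) * ν (algebraMap A F b) := by
    refine (ν.map_sub _ _).trans (max_le ?_ ?_)
    · rw [map_mul, mul_comm]
      exact mul_le_mul_left (h a) _
    · rw [map_mul, mul_comm, mul_right_comm]
      exact mul_le_mul_left (h b) _
  calc _ ≤ (ν (algebraMap A F b))⁻¹ ^ 2 * (c * ν (algebraMap A F a) * ν (algebraMap A F b)) :=
        mul_le_mul_right h1 _
    _ = _ := by field_simp

open Polynomial in
/-- The derivation of `L(X)` extending a derivation of `L[X]`. -/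
def Derivation.toRatFunc {k L : Type*} [Field k] [Field L] [Algebra k L]
    (d : Derivation k L[X] L[X]) : Derivation k (RatFunc L) (RatFunc L) :=
  ((Algebra.linearMap L[X] (RatFunc L)).compDer d).extendFractionRing

open Polynomial in
theorem Derivation.toRatFunc_algebraMap {k L : Type*} [Field k] [Field L] [Algebra k L]
    (d : Derivation k L[X] L[X]) (p : L[X]) :
    d.toRatFunc (algebraMap L[X] (RatFunc L) p) = algebraMap L[X] (RatFunc L) (d p) := by
  rw [Derivation.toRatFunc, Derivation.extendFractionRing_algebraMap]
  rfl

open Polynomial IsDedekindDomain in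
theorem Derivation.valuation_toRatFunc_le_one {k L : Type*} [Field k] [Field L] [Algebra k L]
    (d : Derivation k L[X] L[X]) (w : HeightOneSpectrum L[X]) (x : RatFunc L)
    (hx : w.valuation (RatFunc L) x ≤ 1) : w.valuation (RatFunc L) (d.toRatFunc x) ≤ 1 := by
  obtain ⟨n, b, h⟩ := w.exists_primeCompl_mul_eq_of_integer x hx
  have hb : w.valuation (RatFunc L) (algebraMap L[X] (RatFunc L) b) = 1 :=
    w.valuation_eq_one_iff_notMem.2 b.2
  have h0 : algebraMap L[X] (RatFunc L) b ≠ 0 := fun h' => by simp [h'] at hb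
  rw [eq_div_of_mul_eq h0 h, Derivation.leibniz_div, smul_eq_mul, map_mul, map_pow, map_inv₀, hb,
    inv_one, one_pow, one_mul, Derivation.toRatFunc_algebraMap, Derivation.toRatFunc_algebraMap,
    smul_eq_mul, smul_eq_mul, ← map_mul, ← map_mul, ← map_sub]
  exact w.valuation_le_one _

open Polynomial in
theorem Derivation.inftyValuation_toRatFunc_le {k L : Type*} [Field k] [Field L] [Algebra k L]
    [DecidableEq (RatFunc L)]
    (d : Derivation k L[X] L[X]) (m : ℕ) (hd : ∀ p : L[X], d p ≠ 0 → (d p).natDegree + m ≤ p.natDegree)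
    (x : RatFunc L) :
    RatFunc.inftyValuation L (d.toRatFunc x) ≤ WithZero.exp (-(m : ℤ)) * RatFunc.inftyValuation L x := by
  refine Valuation.derivation_le_of_isFractionRing (A := L[X]) _ _ _ (fun p => ?_) x
  rw [Derivation.toRatFunc_algebraMap]
  by_cases h : d p = 0
  · simp [h]
  · have hp : p ≠ 0 := fun h' => by simp [h'] at h
    rw [RatFunc.inftyValuation_apply, RatFunc.inftyValuation_apply,
      RatFunc.inftyValuation.polynomial _ h, RatFunc.inftyValuation.polynomial _ hp,
      ← WithZero.exp_add, WithZero.exp_le_exp]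
    have := hd p h
    omega

open Polynomial IsDedekindDomain in
theorem exists_ratFunc_derivations_valuations (k L : Type*) [Field k] [Field L] [Algebra k L]
    (d : Derivation k L L) :
    ∃ D₁ D₂ : Derivation k (RatFunc L) (RatFunc L),
      D₁ RatFunc.X = 0 ∧ (∀ a, D₁ (RatFunc.C a) = RatFunc.C (d a)) ∧
      D₂ RatFunc.X = 1 ∧ (∀ a, D₂ (RatFunc.C a) = 0) ∧
      ∀ h : RatFunc L, h ≠ 0 → ∀ r : ℕ, 1 ≤ r →
        ∃ ν : Valuation (RatFunc L) (WithZero (Multiplicative ℤ)),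
          (∀ a : L, a ≠ 0 → ν (RatFunc.C a) = 1) ∧
          ∀ p q, ν p ≤ 1 → ν q ≤ 1 → ν (D₁ p * D₂ q - D₂ p * D₁ q) ^ r < ν h := by
  classical
  let e₁ : Derivation k L[X] L[X] :=
    (PolynomialModule.equivPolynomialSelf (R := L)).toLinearMap.compDer d.mapCoeffs
  let e₂ : Derivation k L[X] L[X] := (Polynomial.derivative' (R := L)).restrictScalars k
  have he₁ : ∀ p i, (e₁ p).coeff i = d (p.coeff i) := fun p i => rfl
  have he₂ : ∀ p, e₂ p = derivative p := fun p => rfl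
  have hC : ∀ a : L, RatFunc.C a = algebraMap L[X] (RatFunc L) (C a) := fun a => rfl
  refine ⟨e₁.toRatFunc, e₂.toRatFunc, ?_, ?_, ?_, ?_, ?_⟩
  · rw [← RatFunc.algebraMap_X, Derivation.toRatFunc_algebraMap]
    convert map_zero (algebraMap L[X] (RatFunc L))
    ext i
    simp [he₁, coeff_X, apply_ite d]
  · intro a
    rw [hC, hC, Derivation.toRatFunc_algebraMap]
    congr 1
    ext i
    simp [he₁, coeff_C, apply_ite d]
  · rw [← RatFunc.algebraMap_X, Derivation.toRatFunc_algebraMap, he₂]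
    simp
  · intro a
    rw [hC, Derivation.toRatFunc_algebraMap, he₂]
    simp
  intro h h0 r hr
  by_cases hh : ∀ w : HeightOneSpectrum L[X], w.valuation (RatFunc L) h ≤ 1
  · obtain ⟨p, rfl⟩ := HeightOneSpectrum.mem_integers_of_valuation_le_one _ _ hh
    have hp : p ≠ 0 := fun h' => by simp [h'] at h0
    refine ⟨RatFunc.inftyValuation L, fun a ha => RatFunc.inftyValuation.C L ha, fun x y hx hy => ?_⟩
    refine lt_of_lt_of_le (b := 1) (pow_lt_one₀ zero_le ?_ (by omega)) ?_
    · have h1 : ∀ z, RatFunc.inftyValuation L z ≤ 1 →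
          RatFunc.inftyValuation L (e₁.toRatFunc z) ≤ 1 := by
        intro z hz
        have := e₁.inftyValuation_toRatFunc_le 0 (fun p _ => by
          rw [add_zero, natDegree_le_iff_coeff_eq_zero]
          intro N hN
          rw [he₁, coeff_eq_zero_of_natDegree_lt hN, map_zero]) z
        simp only [Nat.cast_zero, neg_zero, WithZero.exp_zero, one_mul] at this
        exact this.trans hz
      have h2 : ∀ z, RatFunc.inftyValuation L z ≤ 1 →
          RatFunc.inftyValuation L (e₂.toRatFunc z) < 1 := by
        intro z hz
        have := e₂.inftyValuation_toRatFunc_le 1 (fun p hp => by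
          rw [he₂] at hp ⊢
          have h3 : p.natDegree ≠ 0 := fun h' => hp (derivative_of_natDegree_zero h')
          have := natDegree_derivative_lt h3
          omega) z
        refine this.trans_lt ?_
        refine (mul_le_mul_right hz _).trans_lt ?_
        rw [mul_one, ← WithZero.exp_zero, WithZero.exp_lt_exp]
        simp
      refine (Valuation.map_sub _ _ _).trans_lt (max_lt ?_ ?_)
      · rw [map_mul]
        exact mul_lt_one_of_nonneg_of_lt_one_right (h1 x hx) zero_le (h2 y hy)
      · rw [map_mul]
        exact mul_lt_one_of_nonneg_of_lt_one_left zero_le (h2 x hx) (h1 y hy)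
    · change _ ≤ RatFunc.inftyValuation L (algebraMap L[X] (RatFunc L) p)
      rw [RatFunc.inftyValuation_apply, RatFunc.inftyValuation.polynomial _ hp, ← WithZero.exp_zero,
        WithZero.exp_le_exp]
      simp
  · push Not at hh
    obtain ⟨w, hw⟩ := hh
    refine ⟨w.valuation (RatFunc L), fun a ha => ?_, fun p q hp hq => lt_of_le_of_lt ?_ hw⟩
    · rw [hC]
      have h1 := w.valuation_le_one (K := RatFunc L) (C a)
      have h2 := w.valuation_le_one (K := RatFunc L) (C a⁻¹)
      refine le_antisymm h1 ?_
      have h3 : (algebraMap L[X] (RatFunc L) (C a)) * (algebraMap L[X] (RatFunc L) (C a⁻¹)) = 1 := by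
        rw [← map_mul, ← C_mul, mul_inv_cancel₀ ha]; simp
      have h4 := congrArg (w.valuation (RatFunc L)) h3
      rw [map_mul, map_one] at h4
      rw [← h4]
      exact (mul_le_mul_right h2 _).trans (mul_one _).le
    · refine pow_le_one₀ zero_le ((Valuation.map_sub _ _ _).trans (max_le ?_ ?_))
      · rw [map_mul]
        exact mul_le_one' (e₁.valuation_toRatFunc_le_one w p hp) (e₂.valuation_toRatFunc_le_one w q hq)
      · rw [map_mul]
        exact mul_le_one' (e₂.valuation_toRatFunc_le_one w p hp) (e₁.valuation_toRatFunc_le_one w q hq)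

section Coordinates

/-- The field `k(x,y)`. -/
abbrev CremonaField (k : Type u) [Field k] : Type u := FractionRing (MvPolynomial (Fin 2) k)

/-- The coordinate functions of the plane. -/
def coord (k : Type u) [Field k] (i : Fin 2) : CremonaField k :=
  algebraMap (MvPolynomial (Fin 2) k) _ (MvPolynomial.X i)

open IntermediateField Cardinal

theorem isTranscendenceBasis_of_adjoin_eq_top {k E : Type*} [Field k] [Field E] [Algebra k E]
    {x y : E} (h : k⟮x, y⟯ = ⊤) (htr : 2 ≤ Algebra.trdeg k E) :
    IsTranscendenceBasis k ![x, y] := by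
  have hr : Set.range ![x, y] = {x, y} := by simp [Set.pair_comm]
  have : Algebra.IsAlgebraic (Algebra.adjoin k (Set.range ![x, y])) E := by
    rw [hr]
    constructor
    intro z
    obtain ⟨r, hr, s, hs, rfl⟩ := mem_adjoin_iff_div.1 (show z ∈ k⟮x, y⟯ from h ▸ mem_top)
    have h1 := isAlgebraic_algebraMap (A := E) (⟨r, hr⟩ : Algebra.adjoin k {x, y})
    have h2 := isAlgebraic_algebraMap (A := E) (⟨s, hs⟩ : Algebra.adjoin k {x, y})
    rw [div_eq_mul_inv]
    exact h1.mul h2.inv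
  refine Algebra.IsAlgebraic.isTranscendenceBasis_of_lift_le_trdeg_of_finite k _ ?_
  simpa using htr

/-- A pair of generators of a field of transcendence degree two gives an isomorphism with
the field of rational functions in two variables. -/
theorem exists_algEquiv_of_adjoin_eq_top {k : Type u} {E : Type v} [Field k] [Field E] [Algebra k E]
    {x y : E} (h : k⟮x, y⟯ = ⊤) (htr : 2 ≤ Algebra.trdeg k E) :
    ∃ e : CremonaField k ≃ₐ[k] E, e (coord k 0) = x ∧ e (coord k 1) = y := by
  have hb := isTranscendenceBasis_of_adjoin_eq_top h htr
  have hi : Function.Injective (MvPolynomial.aeval (R := k) ![x, y]) := hb.1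
  let f : CremonaField k →ₐ[k] E := IsFractionRing.liftAlgHom (K := CremonaField k) hi
  have hx : f (coord k 0) = x := by simp [f, coord]
  have hy : f (coord k 1) = y := by simp [f, coord]
  have hs : Function.Surjective f := by
    rw [← AlgHom.fieldRange_eq_top, eq_top_iff, ← h, adjoin_le_iff]
    rintro z (rfl | rfl)
    · exact ⟨_, hx⟩
    · exact ⟨_, hy⟩
  exact ⟨AlgEquiv.ofBijective f ⟨f.injective, hs⟩, hx, hy⟩

theorem adjoin_coord_eq_top (k : Type u) [Field k] : k⟮coord k 0, coord k 1⟯ = ⊤ := by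
  rw [eq_top_iff]
  rintro z -
  obtain ⟨a, b, hb, rfl⟩ := IsFractionRing.div_surjective (A := MvPolynomial (Fin 2) k) z
  have key : ∀ p : MvPolynomial (Fin 2) k, algebraMap _ (CremonaField k) p ∈
      k⟮coord k 0, coord k 1⟯ := by
    intro p
    induction p using MvPolynomial.induction_on with
    | C a =>
      exact (k⟮coord k 0, coord k 1⟯).algebraMap_mem a
    | add p q hp hq => rw [map_add]; exact add_mem hp hq
    | mul_X p i hp =>
      rw [map_mul]
      refine mul_mem hp (subset_adjoin _ _ ?_)
      fin_cases i
      · left; rfl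
      · right; rfl
  exact div_mem (key a) (key b)

theorem two_le_trdeg_cremonaField (k : Type u) [Field k] :
    2 ≤ Algebra.trdeg k (CremonaField k) := by
  have h : Algebra.trdeg k (MvPolynomial (Fin 2) k) ≤ Algebra.trdeg k (CremonaField k) :=
    trdeg_le_of_injective (IsScalarTower.toAlgHom k (MvPolynomial (Fin 2) k) (CremonaField k))
      (IsFractionRing.injective _ _)
  rw [MvPolynomial.trdeg_of_isDomain] at h
  simpa using h

theorem two_le_trdeg_ratFunc_ratFunc (k : Type u) [Field k] :
    2 ≤ Algebra.trdeg k (RatFunc (RatFunc k)) := by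
  have h1 : ∀ (L : Type u) [Field L], 1 ≤ Algebra.trdeg L (RatFunc L) := by
    intro L _
    rw [← Polynomial.trdeg_of_isDomain (R := L)]
    exact trdeg_le_of_injective (IsScalarTower.toAlgHom L (Polynomial L) (RatFunc L))
      (IsFractionRing.injective _ _)
  rw [← trdeg_add_eq k (RatFunc k), ← one_add_one_eq_two]
  exact add_le_add (h1 k) (h1 (RatFunc k))

end Coordinates

section CremonaSubgroups

open IntermediateField

/-- Transport of a derivation along an isomorphism of fields. -/
def Derivation.conjAlgEquiv {k F E : Type*} [Field k] [Field F] [Field E] [Algebra k F] [Algebra k E]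
    (e : F ≃ₐ[k] E) (D : Derivation k E E) : Derivation k F F :=
  Derivation.mk' (e.symm.toLinearMap ∘ₗ (D : E →ₗ[k] E) ∘ₗ e.toLinearMap) fun a b => by simp

theorem Derivation.conjAlgEquiv_apply {k F E : Type*} [Field k] [Field F] [Field E] [Algebra k F]
    [Algebra k E] (e : F ≃ₐ[k] E) (D : Derivation k E E) (x : F) :
    D.conjAlgEquiv e x = e.symm (D (e x)) := rfl

/-- The Jacobian bracket attached to two derivations. -/
def jacobian {k F : Type*} [Field k] [Field F] [Algebra k F] (D₁ D₂ : Derivation k F F) (p q : F) :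
    F :=
  D₁ p * D₂ q - D₂ p * D₁ q

theorem Derivation.eq_zero_of_adjoin_eq_top {k F : Type*} [Field k] [Field F] [Algebra k F]
    (D : Derivation k F F) {x y : F} (h : k⟮x, y⟯ = ⊤) (hx : D x = 0) (hy : D y = 0) (z : F) :
    D z = 0 := by
  have hz : z ∈ k⟮x, y⟯ := h ▸ mem_top
  induction hz using adjoin_induction with
  | mem z hz =>
    rcases hz with rfl | rfl
    exacts [hx, hy]
  | algebraMap a => exact D.map_algebraMap a
  | add a b _ _ ha hb => rw [map_add, ha, hb, add_zero]
  | inv a _ ha => rw [D.leibniz_inv, ha, smul_zero]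
  | mul a b _ _ ha hb => rw [D.leibniz, ha, hb, smul_zero, smul_zero, add_zero]

theorem jacobian_ne_zero_of_adjoin_eq_top {k F : Type*} [Field k] [Field F] [Algebra k F]
    {D₁ D₂ : Derivation k F F} {u v : F} (huv : jacobian D₁ D₂ u v ≠ 0) {x y : F}
    (h : k⟮x, y⟯ = ⊤) : jacobian D₁ D₂ x y ≠ 0 := by
  intro h0
  have key : ∀ p q, (D₁ p • D₂ - D₂ p • D₁) q = jacobian D₁ D₂ p q := fun p q => rfl
  have h1 : ∀ q, jacobian D₁ D₂ x q = 0 := fun q => by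
    rw [← key]
    refine Derivation.eq_zero_of_adjoin_eq_top _ h ?_ ?_ q
    · rw [key, jacobian]; ring
    · rw [key, h0]
  have h2 : ∀ q, jacobian D₁ D₂ y q = 0 := fun q => by
    rw [← key]
    refine Derivation.eq_zero_of_adjoin_eq_top _ h ?_ ?_ q
    · rw [key, jacobian, ← neg_eq_zero, ← h0, jacobian]; ring
    · rw [key, jacobian]; ring
  refine huv ?_
  rw [← key]
  refine Derivation.eq_zero_of_adjoin_eq_top _ h ?_ ?_ v
  · rw [key, jacobian, ← neg_eq_zero, ← h1 u, jacobian]; ring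
  · rw [key, jacobian, ← neg_eq_zero, ← h2 u, jacobian]; ring

theorem exists_jacobian_valuation (k : Type u) [Field k] :
    ∃ D₁ D₂ : Derivation k (CremonaField k) (CremonaField k),
      (∀ x y : CremonaField k, k⟮x, y⟯ = ⊤ → jacobian D₁ D₂ x y ≠ 0) ∧
      ∀ h : CremonaField k, h ≠ 0 → ∀ r : ℕ, 1 ≤ r →
        ∃ ν : Valuation (CremonaField k) (WithZero (Multiplicative ℤ)),
          (∀ z ∈ k⟮coord k 0⟯, z ≠ 0 → ν z = 1) ∧
          ∀ p q, ν p ≤ 1 → ν q ≤ 1 → ν (jacobian D₁ D₂ p q) ^ r < ν h := by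
  let d : Derivation k (RatFunc k) (RatFunc k) := (Polynomial.derivative' (R := k)).toRatFunc
  have hd : d RatFunc.X = 1 := by
    rw [← RatFunc.algebraMap_X, Derivation.toRatFunc_algebraMap]
    change algebraMap _ _ (Polynomial.derivative Polynomial.X) = _
    simp
  obtain ⟨E₁, E₂, h1X, h1C, h2X, h2C, hE⟩ := exists_ratFunc_derivations_valuations k (RatFunc k) d
  have hgen : k⟮(RatFunc.C RatFunc.X : RatFunc (RatFunc k)), (RatFunc.X : RatFunc (RatFunc k))⟯ = ⊤ := by
    set M := k⟮(RatFunc.C RatFunc.X : RatFunc (RatFunc k)), (RatFunc.X : RatFunc (RatFunc k))⟯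
    have hC : ∀ a : RatFunc k, RatFunc.C a ∈ M := by
      intro a
      have ha : a ∈ k⟮(RatFunc.X : RatFunc k)⟯ := by rw [RatFunc.adjoin_X]; exact mem_top
      have : (k⟮(RatFunc.X : RatFunc k)⟯).map
          (IsScalarTower.toAlgHom k (RatFunc k) (RatFunc (RatFunc k))) ≤ M := by
        rw [adjoin_map, adjoin_le_iff, Set.image_singleton, Set.singleton_subset_iff]
        exact subset_adjoin _ _ (Or.inl rfl)
      exact this ⟨a, ha, rfl⟩
    have hX : (RatFunc.X : RatFunc (RatFunc k)) ∈ M := subset_adjoin _ _ (Or.inr rfl)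
    have hP : ∀ p : Polynomial (RatFunc k), algebraMap _ (RatFunc (RatFunc k)) p ∈ M := by
      intro p
      induction p using Polynomial.induction_on' with
      | add p q hp hq => rw [map_add]; exact add_mem hp hq
      | monomial n a =>
        rw [← Polynomial.C_mul_X_pow_eq_monomial, map_mul, map_pow, RatFunc.algebraMap_X]
        exact mul_mem (hC a) (pow_mem hX n)
    rw [eq_top_iff]
    rintro z -
    obtain ⟨a, b, hb, rfl⟩ := IsFractionRing.div_surjective (A := Polynomial (RatFunc k)) z
    exact div_mem (hP a) (hP b)
  obtain ⟨e, he0, he1⟩ := exists_algEquiv_of_adjoin_eq_top hgen (two_le_trdeg_ratFunc_ratFunc k)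
  have hj : ∀ p q, e (jacobian (E₁.conjAlgEquiv e) (E₂.conjAlgEquiv e) p q) =
      E₁ (e p) * E₂ (e q) - E₂ (e p) * E₁ (e q) := by
    intro p q
    simp [jacobian, Derivation.conjAlgEquiv_apply]
  refine ⟨E₁.conjAlgEquiv e, E₂.conjAlgEquiv e, fun x y hxy => ?_, fun h h0 r hr => ?_⟩
  · refine jacobian_ne_zero_of_adjoin_eq_top (u := coord k 0) (v := coord k 1) (fun h0 => ?_) hxy
    have := hj (coord k 0) (coord k 1)
    rw [h0, he0, he1, h1C, hd, h2X, h2C] at this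
    simp at this
  · obtain ⟨ν, hν, H⟩ := hE (e h) (by simpa using h0) r hr
    refine ⟨ν.comap e.toRingEquiv.toRingHom, fun z hz hz0 => ?_, fun p q hp hq => ?_⟩
    · have hr : ∃ a : RatFunc k, e z = RatFunc.C a := by
        have h3 : (k⟮coord k 0⟯).map (e : CremonaField k →ₐ[k] RatFunc (RatFunc k)) ≤
            (IsScalarTower.toAlgHom k (RatFunc k) (RatFunc (RatFunc k))).fieldRange := by
          rw [adjoin_map, adjoin_le_iff, Set.image_singleton, Set.singleton_subset_iff]
          exact ⟨RatFunc.X, he0.symm⟩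
        obtain ⟨a, ha⟩ := h3 ⟨z, hz, rfl⟩
        exact ⟨a, ha.symm⟩
      obtain ⟨a, ha⟩ := hr
      change ν (e z) = 1
      rw [ha]
      refine hν a fun h' => hz0 ?_
      rw [h', map_zero] at ha
      simpa using ha
    · change ν (e _) ^ r < _
      rw [hj]
      exact H _ _ hp hq

section Blowup

open Polynomial

theorem Polynomial.aevalAeval_comp {R A : Type*} [CommRing R] [CommRing A] [Algebra R A] (x y : A)
    (p q : R[X][X]) : aevalAeval x y (p.comp q) = aevalAeval x (aevalAeval x y q) p := by
  have : (aevalAeval x y).comp ((Polynomial.aeval q : R[X][X] →ₐ[R[X]] R[X][X]).restrictScalars R) =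
      aevalAeval x (aevalAeval x y q) := by
    apply algHom_ext'
    · ext; simp
    · simp
  rw [← this]
  simp [comp, aeval_def]

theorem Polynomial.aevalAeval_monomial_monomial {R A : Type*} [CommRing R] [CommRing A]
    [Algebra R A] (x y : A) (i j : ℕ) (c : R) :
    aevalAeval x y (monomial j (monomial i c)) = c • (x ^ i * y ^ j) := by
  simp [Algebra.smul_def, mul_assoc]

theorem Polynomial.Bivariate.coeff_coeff_swap {R : Type*} [CommRing R] (p : R[X][X]) (i j : ℕ) :
    ((Bivariate.swap p).coeff j).coeff i = (p.coeff i).coeff j := by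
  induction p using Polynomial.induction_on' with
  | add p q hp hq => simp only [map_add, coeff_add, hp, hq]
  | monomial n a =>
    induction a using Polynomial.induction_on' with
    | add p q hp hq => simp only [map_add, coeff_add, hp, hq]
    | monomial m a =>
      rw [Bivariate.swap_monomial_monomial]
      simp only [coeff_monomial]
      split_ifs <;> simp_all [coeff_monomial]

variable {k F : Type*} [Field k] [Field F] [Algebra k F]
  {ν : Valuation F (WithZero (Multiplicative ℤ))}

theorem Valuation.aeval_le_one (hν : ∀ c : k, c ≠ 0 → ν (algebraMap k F c) = 1) {y : F}
    (hy : ν y ≤ 1) (g : k[X]) : ν (aeval y g) ≤ 1 := by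
  induction g using Polynomial.induction_on' with
  | add p q hp hq => rw [map_add]; exact (ν.map_add _ _).trans (max_le hp hq)
  | monomial n a =>
    rw [aeval_monomial, map_mul, map_pow]
    refine mul_le_one' ?_ (pow_le_one₀ zero_le hy)
    by_cases ha : a = 0
    · simp [ha]
    · exact (hν a ha).le

theorem Valuation.aevalAeval_le_one (hν : ∀ c : k, c ≠ 0 → ν (algebraMap k F c) = 1) {x y : F}
    (hx : ν x ≤ 1) (hy : ν y ≤ 1) (p : k[X][X]) : ν (aevalAeval x y p) ≤ 1 := by
  induction p using Polynomial.induction_on' with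
  | add p q hp hq => rw [map_add]; exact (ν.map_add _ _).trans (max_le hp hq)
  | monomial n a =>
    rw [← C_mul_X_pow_eq_monomial, map_mul, map_pow, aevalAeval_C, aevalAeval_Y, map_mul, map_pow]
    exact mul_le_one' (Valuation.aeval_le_one hν hx a) (pow_le_one₀ zero_le hy)

/-- Modulo the maximal ideal, a bivariate polynomial may be evaluated at `0` in a variable lying in
the maximal ideal. -/
theorem Valuation.aevalAeval_sub_lt_one (hν : ∀ c : k, c ≠ 0 → ν (algebraMap k F c) = 1) {x y : F}
    (hx : ν x < 1) (hy : ν y ≤ 1) (p : k[X][X]) :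
    ν (aevalAeval x y p - aeval y (p.map constantCoeff)) < 1 := by
  induction p using Polynomial.induction_on' with
  | add p q hp hq =>
    rw [map_add, Polynomial.map_add, map_add, add_sub_add_comm]
    exact ν.map_add_lt hp hq
  | monomial n a =>
    rw [← C_mul_X_pow_eq_monomial, map_mul, map_pow, aevalAeval_C, aevalAeval_Y, Polynomial.map_mul,
      Polynomial.map_pow, map_X, map_C, map_mul, map_pow, aeval_X, aeval_C, ← sub_mul, map_mul,
      map_pow]
    refine mul_lt_one_of_nonneg_of_lt_one_left zero_le ?_ (pow_le_one₀ zero_le hy)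
    conv_lhs => rw [← divX_mul_X_add a]
    simp only [map_add, map_mul, aeval_X, aeval_C, constantCoeff_apply, coeff_X_zero,
      mul_zero, coeff_C_zero, zero_add, add_sub_cancel_right]
    exact mul_lt_one_of_nonneg_of_lt_one_right (Valuation.aeval_le_one hν hx.le _) zero_le hx

theorem Valuation.exists_root_sub_lt_one [IsAlgClosed k]
    (hν : ∀ c : k, c ≠ 0 → ν (algebraMap k F c) = 1) {y : F}
    (hy : ν y ≤ 1) {g : k[X]} (hg : g ≠ 0) (h : ν (aeval y g) < 1) :
    ∃ c : k, g.IsRoot c ∧ ν (y - algebraMap k F c) < 1 := by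
  by_contra! H
  refine h.ne ?_
  have hs := (IsAlgClosed.splits g).eq_prod_roots
  rw [hs, map_mul, aeval_C, map_mul, hν _ (leadingCoeff_ne_zero.2 hg), one_mul, map_multiset_prod,
    map_multiset_prod, Multiset.map_map, Multiset.map_map]
  refine Multiset.prod_eq_one fun z hz => ?_
  obtain ⟨c, hc, rfl⟩ := Multiset.mem_map.1 hz
  have hX : aeval y (X - C c) = y - algebraMap k F c := by simp
  change ν (aeval y (X - C c)) = 1
  rw [hX]
  refine le_antisymm ((ν.map_sub _ _).trans (max_le hy ?_)) (H c (isRoot_of_mem_roots hc))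
  by_cases hc0 : c = 0
  · simp [hc0]
  · exact (hν c hc0).le

theorem jacobian_swap (D₁ D₂ : Derivation k F F) (p q : F) :
    jacobian D₁ D₂ q p = - jacobian D₁ D₂ p q := by
  simp only [jacobian]; ring

theorem jacobian_blowup (D₁ D₂ : Derivation k F F) {s : F} (t : F) (c : k) :
    jacobian D₁ D₂ s (s * t) = s * jacobian D₁ D₂ s (t - algebraMap k F c) := by
  simp only [jacobian, Derivation.leibniz, map_sub, Derivation.map_algebraMap, smul_eq_mul]
  ring

/-- Algebraic part of a blow-up: chart, total transform and exceptional divisor. -/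
theorem Polynomial.exists_blowup {p : k[X][X]} {m : ℕ}
    (hle : ∀ i j, (p.coeff j).coeff i ≠ 0 → m ≤ i + j)
    (hex : ∃ i j, (p.coeff j).coeff i ≠ 0 ∧ i + j = m) :
    ∃ q : k[X][X], p.comp (C X * X) = C (X ^ m) * q ∧ q.map constantCoeff ≠ 0 ∧
      (q.map constantCoeff).natDegree ≤ m := by
  have hdvd : C (X ^ m : k[X]) ∣ p.comp (C X * X) := by
    rw [C_dvd_iff_dvd_coeff]
    intro j
    rw [comp_C_mul_X_coeff, X_pow_dvd_iff]
    intro d hd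
    rw [coeff_mul_X_pow']
    split_ifs with h
    · by_contra h'
      have := hle _ _ h'
      omega
    · rfl
  obtain ⟨q, hq⟩ := hdvd
  have hcoeff : ∀ j, (q.map constantCoeff).coeff j = if j ≤ m then (p.coeff j).coeff (m - j) else 0 := by
    intro j
    have h1 := congrArg (fun r : k[X][X] => (r.coeff j).coeff m) hq
    simp only [comp_C_mul_X_coeff, coeff_C_mul, coeff_mul_X_pow'] at h1
    rw [h1, mul_comm, coeff_mul_X_pow']
    simp
  refine ⟨q, hq, fun h0 => ?_, ?_⟩
  · obtain ⟨i, j, hij, h⟩ := hex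
    have := hcoeff j
    rw [h0, coeff_zero, if_pos (by omega), ← h, Nat.add_sub_cancel] at this
    exact hij this.symm
  · rw [natDegree_le_iff_coeff_eq_zero]
    intro N hN
    rw [hcoeff, if_neg (by omega)]

/-- A single blow-up along a valuation, followed by a recentring. -/
theorem exists_blowup_center [IsAlgClosed k]
    (hν : ∀ c : k, c ≠ 0 → ν (algebraMap k F c) = 1) (D₁ D₂ : Derivation k F F) {m : ℕ} {s t : F}
    {p : k[X][X]} (hs : ν s < 1) (hts : ν t ≤ ν s) (hs0 : s ≠ 0)
    (hp : ∃ i j, (p.coeff j).coeff i ≠ 0 ∧ i + j ≤ m) :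
    ∃ m₀ ≤ m, ∃ (t' : F) (p' : k[X][X]), ν t' ≤ 1 ∧
      jacobian D₁ D₂ s t = s * jacobian D₁ D₂ s t' ∧
      ν (aevalAeval s t p) = ν s ^ m₀ * ν (aevalAeval s t' p') ∧
      (ν (aevalAeval s t' p') = 1 ∨ (1 ≤ m₀ ∧ ν t' < 1 ∧
        ∃ i j, (p'.coeff j).coeff i ≠ 0 ∧ i + j ≤ m₀)) := by
  classical
  have hp' : ∃ n, ∃ i j, (p.coeff j).coeff i ≠ 0 ∧ i + j = n := by
    obtain ⟨i, j, h, -⟩ := hp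
    exact ⟨_, i, j, h, rfl⟩
  obtain ⟨q, hq, hg, hdeg⟩ := exists_blowup (m := Nat.find hp')
    (fun i j h => Nat.find_min' hp' ⟨i, j, h, rfl⟩) (Nat.find_spec hp')
  have hm : Nat.find hp' ≤ m := by
    obtain ⟨i, j, h, hij⟩ := hp
    exact (Nat.find_min' hp' ⟨i, j, h, rfl⟩).trans hij
  set m₀ := Nat.find hp'
  have hνs : ν s ≠ 0 := (ν.ne_zero_iff).2 hs0
  have ht' : ν (t / s) ≤ 1 := by
    rw [map_div₀]
    exact div_le_one_of_le₀ hts zero_le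
  have hst : s * (t / s) = t := mul_div_cancel₀ _ hs0
  have hP : ν (aevalAeval s t p) = ν s ^ m₀ * ν (aevalAeval s (t / s) q) := by
    have h1 := aevalAeval_comp s (t / s) p (C X * X)
    rw [hq, map_mul, map_mul, aevalAeval_C, aevalAeval_C, aevalAeval_Y, aeval_X, map_pow, aeval_X, hst] at h1
    rw [← h1, map_mul, map_pow]
  have hj := jacobian_blowup D₁ D₂ (s := s) (t / s)
  rw [hst] at hj
  rcases (Valuation.aevalAeval_le_one hν hs.le ht' q).eq_or_lt with h1 | h1
  · refine ⟨m₀, hm, t / s, q, ht', ?_, hP, Or.inl h1⟩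
    simpa using hj 0
  · have h2 : ν (aeval (t / s) (q.map constantCoeff)) < 1 := by
      have := ν.map_sub_lt h1 (Valuation.aevalAeval_sub_lt_one hν hs ht' q)
      rwa [sub_sub_cancel] at this
    obtain ⟨c, hc, hνc⟩ := Valuation.exists_root_sub_lt_one hν ht' hg h2
    have hm0 : 1 ≤ m₀ := by
      by_contra hlt
      rw [eq_C_of_natDegree_eq_zero (p := q.map constantCoeff) (by omega)] at hc hg
      simp only [IsRoot.def, eval_C] at hc
      rw [hc, C_0] at hg
      exact hg rfl
    have hcomp : (q.comp (X + C (C c))).map constantCoeff =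
        (q.map constantCoeff).comp (X + C c) := by
      rw [Polynomial.map_comp]
      simp
    refine ⟨m₀, hm, t / s - algebraMap k F c, q.comp (X + C (C c)), hνc.le, hj c, ?_,
      Or.inr ⟨hm0, hνc, 0, ?_⟩⟩
    · rw [hP, aevalAeval_comp]
      simp
    · by_contra! hall
      have h3 : (q.map constantCoeff).comp (X + C c) = 0 := by
        ext j
        by_cases hj : j ≤ m₀
        · by_contra h4
          rw [← hcomp, coeff_map, coeff_zero] at h4
          have := hall j h4
          omega
        · refine coeff_eq_zero_of_natDegree_lt ?_
          rw [natDegree_comp, natDegree_X_add_C, mul_one]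
          omega
      rcases comp_eq_zero_iff.1 h3 with h4 | ⟨-, h4⟩
      · exact hg h4
      · have := congrArg natDegree h4
        rw [natDegree_X_add_C, natDegree_C] at this
        exact one_ne_zero this

/-- Valuative blow-up estimate: a function of multiplicity at most `m` at a point
is bounded below in terms of the discrepancy of any valuation centred there. -/
theorem exists_jacobian_le_of_multiplicity_le [IsAlgClosed k]
    (hν : ∀ c : k, c ≠ 0 → ν (algebraMap k F c) = 1) (D₁ D₂ : Derivation k F F) (N : ℕ) :
    ∀ (m : ℕ) (s t : F) (p : k[X][X]), ν s < 1 → ν t < 1 → jacobian D₁ D₂ s t ≠ 0 →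
      (∃ i j, (p.coeff j).coeff i ≠ 0 ∧ i + j ≤ m) →
      WithZero.exp (-(N : ℤ)) ≤ ν (aevalAeval s t p) →
      ∃ p₁ p₂ : F, ν p₁ ≤ 1 ∧ ν p₂ ≤ 1 ∧ ν (jacobian D₁ D₂ s t) ≤ ν (jacobian D₁ D₂ p₁ p₂) ∧
        ν (jacobian D₁ D₂ s t) ^ m ≤ ν (aevalAeval s t p) * ν (jacobian D₁ D₂ p₁ p₂) ^ m := by
  induction N using Nat.strong_induction_on with
  | _ N ih =>
    intro m s t p hs ht hst hp hP
    wlog hts : ν t ≤ ν s generalizing s t p with H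
    · have := H t s (Bivariate.swap p) ht hs (by rwa [jacobian_swap, neg_ne_zero])
        (by
          obtain ⟨i, j, h, hij⟩ := hp
          exact ⟨j, i, by rwa [Bivariate.coeff_coeff_swap], by omega⟩)
        (by rwa [Bivariate.aevalAeval_swap]) (le_of_not_ge hts)
      rwa [Bivariate.aevalAeval_swap, jacobian_swap, Valuation.map_neg] at this
    have hs0 : s ≠ 0 := by
      rintro rfl
      simp [jacobian] at hst
    have hνs : ν s ≠ 0 := (ν.ne_zero_iff).2 hs0
    obtain ⟨m₀, hm, t', p', ht', hj, hPP, hor⟩ := exists_blowup_center hν D₁ D₂ hs hts hs0 hp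
    have hj0 : jacobian D₁ D₂ s t' ≠ 0 := fun h => by simp [hj, h] at hst
    have finish : ∀ p₁ p₂ : F, ν (jacobian D₁ D₂ s t') ≤ ν (jacobian D₁ D₂ p₁ p₂) →
        ν (jacobian D₁ D₂ s t') ^ m₀ ≤ ν (aevalAeval s t' p') * ν (jacobian D₁ D₂ p₁ p₂) ^ m₀ →
        ν (jacobian D₁ D₂ s t) ≤ ν (jacobian D₁ D₂ p₁ p₂) ∧
        ν (jacobian D₁ D₂ s t) ^ m ≤ ν (aevalAeval s t p) * ν (jacobian D₁ D₂ p₁ p₂) ^ m := by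
      intro p₁ p₂ h1 h2
      have h3 : ν (jacobian D₁ D₂ s t) ≤ ν (jacobian D₁ D₂ p₁ p₂) := by
        rw [hj, map_mul]
        exact (mul_le_of_le_one_left zero_le hs.le).trans h1
      refine ⟨h3, ?_⟩
      obtain ⟨l, rfl⟩ := Nat.exists_eq_add_of_le hm
      rw [pow_add, pow_add, ← mul_assoc]
      refine mul_le_mul' ?_ (pow_le_pow_left' h3 l)
      rw [hj, hPP, map_mul, mul_pow, mul_assoc]
      exact mul_le_mul_right h2 _
    have hle : ν (aevalAeval s t' p') ≤ 1 := Valuation.aevalAeval_le_one hν hs.le ht' p'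
    rcases hor with h1 | ⟨hm0, ht1, hex⟩
    · refine ⟨s, t', hs.le, ht', finish s t' le_rfl ?_⟩
      rw [h1, one_mul]
    have hlt : ν s ^ m₀ ≤ WithZero.exp (-1 : ℤ) := by
      refine (pow_le_of_le_one zero_le hs.le (by omega)).trans ?_
      rw [← WithZero.lt_mul_exp_iff_le WithZero.exp_ne_zero, ← WithZero.exp_add]
      simpa using hs
    have hlt2 := hP.trans (hPP.le.trans (mul_le_mul_left hlt _))
    obtain _ | N := N
    · exfalso
      have := hlt2.trans (mul_le_mul_right hle _)
      rw [mul_one, WithZero.exp_le_exp] at this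
      simp at this
    · obtain ⟨p₁, p₂, h1, h2, h3, h4⟩ := ih N N.lt_succ_self m₀ s t' p' hs ht1 hj0 hex (by
        have h5 : WithZero.exp (-(N : ℤ)) = WithZero.exp (1 : ℤ) * WithZero.exp (-((N + 1 : ℕ) : ℤ)) := by
          rw [← WithZero.exp_add]; congr 1; push_cast; ring
        rw [h5]
        refine (mul_le_mul_right hlt2 _).trans ?_
        rw [← mul_assoc, ← WithZero.exp_add]
        simp)
      exact ⟨p₁, p₂, h1, h2, finish p₁ p₂ h3 h4⟩

/-- Monomials with exponents in `Σ` span this space of functions. -/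
def monomialSpan (k : Type*) {F : Type*} [Field k] [Field F] [Algebra k F] (x y : F)
    (E : Set (ℕ × ℕ)) : Submodule k F :=
  Submodule.span k (Set.image (fun e => x ^ e.1 * y ^ e.2) E)

theorem monomial_mem_monomialSpan {x y : F} {E : Set (ℕ × ℕ)} (i j : ℕ) (h : (i, j) ∈ E) :
    x ^ i * y ^ j ∈ monomialSpan k x y E :=
  Submodule.subset_span ⟨(i, j), h, rfl⟩

theorem monomialSpan_mono (x y : F) {E E' : Set (ℕ × ℕ)} (h : E ⊆ E') :
    monomialSpan k x y E ≤ monomialSpan k x y E' :=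
  Submodule.span_mono (Set.image_mono h)

theorem mul_mem_monomialSpan {x y x' y' c P : F} {E E' : Set (ℕ × ℕ)}
    (hc : ∀ e ∈ E, c * (x ^ e.1 * y ^ e.2) ∈ monomialSpan k x' y' E')
    (hP : P ∈ monomialSpan k x y E) : c * P ∈ monomialSpan k x' y' E' := by
  have : monomialSpan k x y E ≤ (monomialSpan k x' y' E').comap (LinearMap.mulLeft k c) := by
    rw [monomialSpan, Submodule.span_le]
    rintro _ ⟨e, he, rfl⟩
    exact hc e he
  exact this hP

theorem mem_monomialSpan_iff {x y P : F} {E : Set (ℕ × ℕ)} : P ∈ monomialSpan k x y E ↔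
    ∃ p : k[X][X], aevalAeval x y p = P ∧ ∀ i j, (p.coeff j).coeff i ≠ 0 → (i, j) ∈ E := by
  constructor
  · intro h
    induction h using Submodule.span_induction with
    | mem z hz =>
      obtain ⟨⟨i, j⟩, he, rfl⟩ := hz
      refine ⟨monomial j (monomial i 1), by simp, fun i' j' h => ?_⟩
      rw [coeff_monomial] at h
      split_ifs at h with h1
      · rw [coeff_monomial] at h
        split_ifs at h with h2
        · rwa [← h1, ← h2]
        · exact absurd rfl h
      · exact absurd (coeff_zero _) h
    | zero => exact ⟨0, map_zero _, fun i j h => absurd (by simp) h⟩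
    | add P Q _ _ hP hQ =>
      obtain ⟨p, rfl, hp⟩ := hP
      obtain ⟨q, rfl, hq⟩ := hQ
      refine ⟨p + q, map_add _ _ _, fun i j h => ?_⟩
      by_cases h1 : (p.coeff j).coeff i = 0
      · refine hq i j fun h2 => h ?_
        rw [coeff_add, coeff_add, h1, h2, add_zero]
      · exact hp i j h1
    | smul c P _ hP =>
      obtain ⟨p, rfl, hp⟩ := hP
      refine ⟨c • p, map_smul _ _ _, fun i j h => hp i j fun h1 => h ?_⟩
      rw [coeff_smul, coeff_smul, h1, smul_zero]
  · rintro ⟨p, rfl, hp⟩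
    rw [p.as_sum_support, map_sum]
    refine Submodule.sum_mem _ fun j _ => ?_
    rw [(p.coeff j).as_sum_support, map_sum, map_sum]
    refine Submodule.sum_mem _ fun i hi => ?_
    rw [aevalAeval_monomial_monomial]
    exact Submodule.smul_mem _ _ (monomial_mem_monomialSpan i j (hp i j (mem_support_iff.1 hi)))

/-- Exponents of the sections of a line bundle on a Hirzebruch surface. -/
def hirzebruchExponents (n : ℤ) (a : ℕ) (b : ℤ) : Set (ℕ × ℕ) :=
  {e | e.2 ≤ a ∧ (e.1 : ℤ) + n * e.2 ≤ b}

theorem exists_aevalAeval_mem_monomialSpan (x y : F) {p : k[X][X]} {a : ℕ} (hp : p.natDegree ≤ a) :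
    ∃ b₀ : ℕ, ∀ b : ℕ, b₀ ≤ b →
      aevalAeval x y p ∈ monomialSpan k x y (hirzebruchExponents 0 a b) := by
  refine ⟨p.support.sup fun j => (p.coeff j).natDegree, fun b hb => ?_⟩
  refine mem_monomialSpan_iff.2 ⟨p, rfl, fun i j h => ?_⟩
  have h1 : p.coeff j ≠ 0 := fun h' => by simp [h'] at h
  have h2 : (p.coeff j).natDegree ≤ b :=
    (Finset.le_sup (f := fun j => (p.coeff j).natDegree) (mem_support_iff.2 h1)).trans hb
  have h3 : i ≤ (p.coeff j).natDegree := le_natDegree_of_ne_zero h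
  refine ⟨(le_natDegree_of_ne_zero h1).trans hp, ?_⟩
  push_cast
  rw [zero_mul, add_zero]
  exact_mod_cast h3.trans h2

end Blowup

section Models

open Polynomial

variable {k F : Type*} [Field k] [Field F] [Algebra k F]

/-- A class of pairs of generators closed under the elementary moves. -/
structure IsGeneratorClass (k : Type*) {F : Type*} [Field k] [Field F] [Algebra k F]
    (S : F → F → Prop) : Prop where
  adjoin_eq_top : ∀ x y, S x y → k⟮x, y⟯ = ⊤
  swap : ∀ x y, S x y → S y x
  right : ∀ x y y', S x y → k⟮x, y'⟯ = ⊤ → S x y'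

theorem IsGeneratorClass.change_right {S : F → F → Prop} (hS : IsGeneratorClass k S) {x y y' : F}
    (h : S x y) (hy : y ∈ k⟮x, y'⟯) : S x y' := by
  refine hS.right x y y' h (eq_top_iff.2 ?_)
  rw [← hS.adjoin_eq_top x y h, adjoin_le_iff]
  rintro z (rfl | rfl)
  · exact subset_adjoin _ _ (Or.inl rfl)
  · exact hy

theorem IsGeneratorClass.ne_zero {S : F → F → Prop} (hS : IsGeneratorClass k S)
    {D₁ D₂ : Derivation k F F} (hD : ∀ x y : F, k⟮x, y⟯ = ⊤ → jacobian D₁ D₂ x y ≠ 0) {x y : F}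
    (h : S x y) : x ≠ 0 ∧ y ≠ 0 := by
  have := hD x y (hS.adjoin_eq_top x y h)
  constructor
  · rintro rfl; simp [jacobian] at this
  · rintro rfl; simp [jacobian] at this

theorem IsGeneratorClass.mul_zpow {S : F → F → Prop} (hS : IsGeneratorClass k S) {x y : F}
    (hx : x ≠ 0) (h : S x y) (n : ℤ) : S x (y * x ^ n) := by
  refine hS.change_right h ?_
  have hx' : x ∈ k⟮x, y * x ^ n⟯ := subset_adjoin _ _ (Or.inl rfl)
  have : y * x ^ n * x ^ (-n) ∈ k⟮x, y * x ^ n⟯ :=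
    mul_mem (subset_adjoin _ _ (Or.inr rfl)) (zpow_mem hx' _)
  rwa [mul_assoc, ← zpow_add₀ hx, add_neg_cancel, zpow_zero, mul_one] at this

theorem IsGeneratorClass.inv_right {S : F → F → Prop} (hS : IsGeneratorClass k S) {x y : F}
    (h : S x y) : S x y⁻¹ := by
  refine hS.change_right h ?_
  have : y⁻¹⁻¹ ∈ k⟮x, y⁻¹⟯ := inv_mem (subset_adjoin _ _ (Or.inr rfl))
  rwa [inv_inv] at this

theorem IsGeneratorClass.sub_right {S : F → F → Prop} (hS : IsGeneratorClass k S) {x y : F}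
    (h : S x y) (c : k) : S x (y - algebraMap k F c) := by
  refine hS.change_right h ?_
  have : y - algebraMap k F c + algebraMap k F c ∈ k⟮x, y - algebraMap k F c⟯ :=
    add_mem (subset_adjoin _ _ (Or.inr rfl)) (IntermediateField.algebraMap_mem _ c)
  rwa [sub_add_cancel] at this

/-- A presentation of `u` as a quotient `P / Q` of combinations of monomials with
prescribed exponents in a pair of generators. -/
structure IsModel (k : Type*) {F : Type*} [Field k] [Field F] [Algebra k F] (S : F → F → Prop)
    (u : F) (E : Set (ℕ × ℕ)) (x y P Q : F) : Prop where
  mem_class : S x y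
  num_mem : P ∈ monomialSpan k x y E
  den_mem : Q ∈ monomialSpan k x y E
  den_ne_zero : Q ≠ 0
  mul_den : u * Q = P

variable {S : F → F → Prop} {u : F}

theorem IsModel.transform {E E' : Set (ℕ × ℕ)} {x y P Q x' y' c : F} (h : IsModel k S u E x y P Q)
    (hS : S x' y') (hc : c ≠ 0)
    (hE : ∀ e ∈ E, c * (x ^ e.1 * y ^ e.2) ∈ monomialSpan k x' y' E') :
    IsModel k S u E' x' y' (c * P) (c * Q) where
  mem_class := hS
  num_mem := mul_mem_monomialSpan hE h.num_mem
  den_mem := mul_mem_monomialSpan hE h.den_mem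
  den_ne_zero := mul_ne_zero hc h.den_ne_zero
  mul_den := by rw [← h.mul_den]; ring

theorem IsModel.transform_monomial {E E' : Set (ℕ × ℕ)} {x y P Q x' y' c : F}
    (h : IsModel k S u E x y P Q) (hS : S x' y') (hc : c ≠ 0)
    (hE : ∀ i j, (i, j) ∈ E → ∃ i' j', (i', j') ∈ E' ∧ c * (x ^ i * y ^ j) = x' ^ i' * y' ^ j') :
    IsModel k S u E' x' y' (c * P) (c * Q) := by
  refine h.transform hS hc fun e he => ?_
  obtain ⟨i', j', h1, h2⟩ := hE e.1 e.2 he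
  rw [h2]
  exact monomial_mem_monomialSpan _ _ h1

theorem IsModel.mono {E E' : Set (ℕ × ℕ)} {x y P Q : F} (h : IsModel k S u E x y P Q)
    (hE : E ⊆ E') : IsModel k S u E' x y P Q :=
  { h with num_mem := monomialSpan_mono x y hE h.num_mem
           den_mem := monomialSpan_mono x y hE h.den_mem }

/-- The fibre degree `a` is minimal. -/
def MinimalFibreDegree (k : Type*) {F : Type*} [Field k] [Field F] [Algebra k F]
    (S : F → F → Prop) (u : F) (a : ℕ) : Prop :=
  ∀ a' < a, ∀ (n b : ℤ) (x y P Q : F), ¬ IsModel k S u (hirzebruchExponents n a' b) x y P Q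

/-- The second degree `2 * b - n * a` is minimal among the models of fibre degree `a`. -/
def MinimalDegree (k : Type*) {F : Type*} [Field k] [Field F] [Algebra k F]
    (S : F → F → Prop) (u : F) (a : ℕ) (δ : ℤ) : Prop :=
  ∀ (n b : ℤ) (x y P Q : F), IsModel k S u (hirzebruchExponents n a b) x y P Q → δ ≤ 2 * b - n * a

variable {a : ℕ} {n b : ℤ} {x y P Q : F}

theorem MinimalFibreDegree.not_dvd (ha : MinimalFibreDegree k S u a) (ha1 : 1 ≤ a) (hy : y ≠ 0) :
    ¬ IsModel k S u (hirzebruchExponents n a b ∩ {e | 1 ≤ e.2}) x y P Q := by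
  intro h
  refine ha (a - 1) (by omega) n (b - n) x y _ _
    (h.transform_monomial h.mem_class (inv_ne_zero hy) ?_)
  rintro i j ⟨⟨h1, h2⟩, h3⟩
  simp only [Set.mem_ofPred_eq] at h1 h2 h3
  refine ⟨i, j - 1, ⟨by simp only; omega, ?_⟩, ?_⟩
  · simp only
    rw [Nat.cast_sub h3]
    push_cast
    linarith
  · obtain ⟨l, rfl⟩ := Nat.exists_eq_add_of_le h3
    rw [add_tsub_cancel_left, pow_add]
    field_simp

theorem MinimalFibreDegree.nonneg (ha : MinimalFibreDegree k S u a) (ha1 : 1 ≤ a) (hy : y ≠ 0)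
    (h : IsModel k S u (hirzebruchExponents n a b) x y P Q) : 0 ≤ b := by
  by_contra hb
  refine ha.not_dvd ha1 hy (h.mono fun e he => ⟨he, ?_⟩)
  obtain ⟨h1, h2⟩ := he
  by_contra h3
  simp only [Set.mem_ofPred_eq, not_le, Nat.lt_one_iff] at h3
  rw [h3] at h2
  push_cast at h2
  linarith [Int.natCast_nonneg e.1]

theorem MinimalFibreDegree.mul_le (ha : MinimalFibreDegree k S u a) (ha1 : 1 ≤ a)
    (h : IsModel k S u (hirzebruchExponents n a b) x y P Q) : n * a ≤ b := by
  by_contra hb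
  refine ha (a - 1) (by omega) n b x y P Q (h.mono fun e he => ⟨?_, he.2⟩)
  obtain ⟨h1, h2⟩ := he
  by_contra h3
  have h4 : e.2 = a := by omega
  rw [h4] at h2
  linarith [Int.natCast_nonneg e.1]

theorem MinimalDegree.not_dvd {δ : ℤ} (hδ : MinimalDegree k S u a δ) (hb : 2 * b - n * a = δ)
    (hx : x ≠ 0) : ¬ IsModel k S u (hirzebruchExponents n a b ∩ {e | 1 ≤ e.1}) x y P Q := by
  intro h
  have := hδ n (b - 1) x y _ _ (h.transform_monomial h.mem_class (inv_ne_zero hx) (by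
    rintro i j ⟨⟨h1, h2⟩, h3⟩
    simp only [Set.mem_ofPred_eq] at h1 h2 h3
    obtain ⟨l, rfl⟩ := Nat.exists_eq_add_of_le h3
    refine ⟨l, j, ⟨h1, ?_⟩, ?_⟩
    · push_cast at h2 ⊢
      linarith
    · rw [pow_add]
      field_simp))
  linarith

theorem MinimalDegree.multiplicity_le {δ : ℤ} (hδ : MinimalDegree k S u a δ)
    (hb : 2 * b - n * a = δ) (hS : IsGeneratorClass k S) (hx : x ≠ 0) {m : ℕ}
    (h : IsModel k S u (hirzebruchExponents n a b ∩ {e | m ≤ e.1 + e.2}) x y P Q) :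
    2 * m ≤ a := by
  have h1 := hS.mul_zpow hx h.mem_class (-1)
  have := hδ (n - 1) (b - m) x _ _ _ (h.transform_monomial h1 (inv_ne_zero (pow_ne_zero m hx)) (by
    rintro i j ⟨⟨h1, h2⟩, h3⟩
    simp only [Set.mem_ofPred_eq] at h1 h2 h3
    obtain ⟨l, hl⟩ := Nat.exists_eq_add_of_le h3
    refine ⟨l, j, ⟨h1, ?_⟩, ?_⟩
    · have : (i : ℤ) + j = m + l := by exact_mod_cast hl
      push_cast at h2 ⊢
      linarith
    · have h4 : x ^ i * x ^ j = x ^ m * x ^ l := by rw [← pow_add, hl, pow_add]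
      rw [zpow_neg_one, mul_pow, inv_pow]
      field_simp
      linear_combination y ^ j * h4))
  have h2 : (2 * m : ℤ) ≤ a := by linarith
  exact_mod_cast h2

theorem MinimalFibreDegree.multiplicity_le (ha : MinimalFibreDegree k S u a) (ha1 : 1 ≤ a)
    (hS : IsGeneratorClass k S) (hx : x ≠ 0) {m : ℕ}
    (h : IsModel k S u (hirzebruchExponents 1 a b ∩ {e | m ≤ e.1 + e.2}) x y P Q) :
    (m : ℤ) ≤ b - a := by
  by_contra hm
  have h1 := hS.swap _ _ (hS.mul_zpow hx h.mem_class (-1))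
  refine ha (b - m).toNat (by omega) 0 a _ x _ _ (h.transform_monomial h1
    (inv_ne_zero (pow_ne_zero m hx)) ?_)
  rintro i j ⟨⟨h1, h2⟩, h3⟩
  simp only [Set.mem_ofPred_eq] at h1 h2 h3
  obtain ⟨l, hl⟩ := Nat.exists_eq_add_of_le h3
  refine ⟨j, l, ⟨?_, ?_⟩, ?_⟩
  · simp only
    omega
  · simp only
    omega
  · have h4 : x ^ i * x ^ j = x ^ m * x ^ l := by rw [← pow_add, hl, pow_add]
    rw [zpow_neg_one, mul_pow, inv_pow]
    field_simp
    linear_combination y ^ j * h4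

theorem MinimalFibreDegree.multiplicity_le_neg (ha : MinimalFibreDegree k S u a) (ha1 : 1 ≤ a)
    (hy : y ≠ 0) {m : ℕ}
    (h : IsModel k S u (hirzebruchExponents (-1) a b ∩ {e | m ≤ e.1 + e.2}) x y P Q) :
    (m : ℤ) ≤ b := by
  by_contra hm
  refine ha.not_dvd ha1 hy (h.mono fun e he => ⟨he.1, ?_⟩)
  obtain ⟨⟨h1, h2⟩, h3⟩ := he
  simp only [Set.mem_ofPred_eq] at h3 ⊢
  omega

theorem MinimalFibreDegree.le_of_zero (ha : MinimalFibreDegree k S u a) (ha1 : 1 ≤ a)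
    (hS : IsGeneratorClass k S)
    (h : IsModel k S u (hirzebruchExponents 0 a b) x y P Q) : (a : ℤ) ≤ b := by
  by_contra hb
  refine ha b.toNat (by omega) 0 a y x _ _ (h.transform_monomial (hS.swap _ _ h.mem_class)
    one_ne_zero ?_)
  rintro i j ⟨h1, h2⟩
  simp only at h1 h2
  refine ⟨j, i, ⟨?_, ?_⟩, by ring⟩
  · simp only; omega
  · simp only; omega

theorem IsModel.invX (hS : IsGeneratorClass k S) (hx : x ≠ 0)
    (h : IsModel k S u (hirzebruchExponents n a b) x y P Q) :
    IsModel k S u (hirzebruchExponents n a b) x⁻¹ (y * x ^ (-n)) (x ^ (-b) * P) (x ^ (-b) * Q) := by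
  have h1 := hS.swap _ _ (hS.inv_right (hS.swap _ _ (hS.mul_zpow hx h.mem_class (-n))))
  refine h.transform_monomial h1 (zpow_ne_zero _ hx) ?_
  rintro i j ⟨h1, h2⟩
  simp only at h1 h2
  obtain ⟨l, hl⟩ : ∃ l : ℕ, b = l + i + n * j := ⟨(b - i - n * j).toNat, by omega⟩
  refine ⟨l, j, ⟨h1, by simp only; linarith⟩, ?_⟩
  have h3 : x ^ (-b) * x ^ i = x⁻¹ ^ l * (x ^ (-n)) ^ j := by
    rw [inv_pow, ← zpow_natCast (x ^ (-n)) j, ← zpow_mul, ← zpow_natCast x l, ← zpow_neg,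
      ← zpow_natCast x i, ← zpow_add₀ hx, ← zpow_add₀ hx]
    congr 1
    linarith
  rw [← mul_assoc, h3, mul_pow]
  ring

theorem IsModel.invY (hS : IsGeneratorClass k S) (hy : y ≠ 0)
    (h : IsModel k S u (hirzebruchExponents n a b) x y P Q) :
    IsModel k S u (hirzebruchExponents (-n) a (b - n * a)) x y⁻¹ ((y ^ a)⁻¹ * P)
      ((y ^ a)⁻¹ * Q) := by
  refine h.transform_monomial (hS.inv_right h.mem_class) (inv_ne_zero (pow_ne_zero _ hy)) ?_
  rintro i j ⟨h1, h2⟩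
  simp only at h1 h2
  obtain ⟨l, rfl⟩ := Nat.exists_eq_add_of_le h1
  refine ⟨i, l, ⟨by simp, ?_⟩, ?_⟩
  · push_cast at h2 ⊢
    linarith
  · rw [pow_add, inv_pow]
    field_simp

end Models

section Elimination

open Polynomial

variable {k : Type*} [Field k]

theorem Polynomial.exists_map_eq_C_mul (f : (RatFunc k)[X]) :
    ∃ (d : k[X]) (f' : k[X][X]), d ≠ 0 ∧
      f'.map (algebraMap k[X] (RatFunc k)) = C (algebraMap k[X] (RatFunc k) d) * f := by
  obtain ⟨d, hd0, hd⟩ := IsLocalization.integerNormalization_spec (nonZeroDivisors k[X]) f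
  refine ⟨d, IsLocalization.integerNormalization (nonZeroDivisors k[X]) f,
    nonZeroDivisors.ne_zero hd0, ?_⟩
  rw [hd, Algebra.smul_def]
  rfl

/-- Two polynomials over `k[X]` either have a nonzero resultant relation or a common factor. -/
theorem Polynomial.exists_bezout_or_common_factor (p q : k[X][X]) {a : ℕ} (hp : p.natDegree ≤ a)
    (hq : q.natDegree ≤ a) :
    (∃ (A B : k[X][X]) (d : k[X]), d ≠ 0 ∧ A * p + B * q = C d) ∨
    ∃ (p' q' G : k[X][X]) (d : k[X]), d ≠ 0 ∧ C d * p = G * p' ∧ C d * q = G * q' ∧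
      p'.natDegree ≤ a - 1 ∧ q'.natDegree ≤ a - 1 := by
  set φ := algebraMap k[X] (RatFunc k) with hφ
  have hinj : Function.Injective (Polynomial.map φ) :=
    Polynomial.map_injective _ (IsFractionRing.injective k[X] (RatFunc k))
  classical
  by_cases hco : IsCoprime (p.map φ) (q.map φ)
  · left
    obtain ⟨A, B, hAB⟩ := hco
    obtain ⟨d₁, A', h1, hA⟩ := exists_map_eq_C_mul A
    obtain ⟨d₂, B', h2, hB⟩ := exists_map_eq_C_mul B
    rw [← hφ] at hA hB
    refine ⟨C d₂ * A', C d₁ * B', d₁ * d₂, mul_ne_zero h1 h2, hinj ?_⟩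
    simp only [Polynomial.map_add, Polynomial.map_mul, map_C, hA, hB, map_mul]
    linear_combination C (φ d₁) * C (φ d₂) * hAB
  · right
    by_cases h0 : p = 0 ∧ q = 0
    · exact ⟨0, 0, 0, 1, one_ne_zero, by simp [h0], by simp [h0], by simp, by simp⟩
    rw [← EuclideanDomain.gcd_isUnit_iff] at hco
    set g := EuclideanDomain.gcd (p.map φ) (q.map φ)
    obtain ⟨P, hP⟩ : g ∣ p.map φ := EuclideanDomain.gcd_dvd_left _ _
    obtain ⟨Q, hQ⟩ : g ∣ q.map φ := EuclideanDomain.gcd_dvd_right _ _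
    have hg : g ≠ 0 := by
      intro hg
      rw [hg, zero_mul, Polynomial.map_eq_zero_iff (IsFractionRing.injective k[X] (RatFunc k))]
        at hP hQ
      exact h0 ⟨hP, hQ⟩
    have hg1 : 1 ≤ g.natDegree := by
      by_contra h
      refine hco (Polynomial.isUnit_iff_degree_eq_zero.2 ?_)
      rw [degree_eq_natDegree hg]
      simp only [not_le, Nat.lt_one_iff] at h
      rw [h]; rfl
    have hdeg : ∀ (f : k[X][X]) (F : (RatFunc k)[X]) (f' : k[X][X]) (d : k[X]), f.natDegree ≤ a →
        f.map φ = g * F → f'.map φ = C (φ d) * F → f'.natDegree ≤ a - 1 := by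
      intro f F f' d hf h1 h2
      rw [← natDegree_map_eq_of_injective (IsFractionRing.injective k[X] (RatFunc k)) f', ← hφ, h2]
      refine (natDegree_C_mul_le _ _).trans ?_
      rcases eq_or_ne F 0 with rfl | hF
      · simp
      rw [← natDegree_map_eq_of_injective (IsFractionRing.injective k[X] (RatFunc k)) f, ← hφ, h1,
        natDegree_mul hg hF] at hf
      omega
    obtain ⟨d₁, G, h1, hG⟩ := exists_map_eq_C_mul g
    obtain ⟨d₂, P', h2, hP'⟩ := exists_map_eq_C_mul P
    obtain ⟨d₃, Q', h3, hQ'⟩ := exists_map_eq_C_mul Q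
    rw [← hφ] at hG hP' hQ'
    refine ⟨C d₃ * P', C d₂ * Q', G, d₁ * d₂ * d₃, mul_ne_zero (mul_ne_zero h1 h2) h3,
      hinj ?_, hinj ?_, (natDegree_C_mul_le _ _).trans (hdeg p P P' d₂ hp hP hP'),
      (natDegree_C_mul_le _ _).trans (hdeg q Q Q' d₃ hq hQ hQ')⟩
    · simp only [Polynomial.map_mul, map_C, hG, hP', hP, map_mul]
      ring
    · simp only [Polynomial.map_mul, map_C, hG, hQ', hQ, map_mul]
      ring

end Elimination

section Models

open Polynomial

variable {k F : Type*} [Field k] [Field F] [Algebra k F] {S : F → F → Prop} {u : F}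
  {a : ℕ} {n b : ℤ} {x y P Q : F}

theorem sub_add_pow_mem_span (x : F) (c : k) (i : ℕ) :
    x ^ i ∈ Submodule.span k (Set.image (fun l => (x - algebraMap k F c) ^ l) {l | l ≤ i}) := by
  have : x ^ i = ((x - algebraMap k F c) + algebraMap k F c) ^ i := by rw [sub_add_cancel]
  rw [this, add_pow]
  refine Submodule.sum_mem _ fun l hl => ?_
  have h1 : (x - algebraMap k F c) ^ l * algebraMap k F c ^ (i - l) * (i.choose l : F) =
      (c ^ (i - l) * (i.choose l : k)) • (x - algebraMap k F c) ^ l := by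
    rw [Algebra.smul_def, map_mul, map_pow, map_natCast]
    ring
  rw [h1]
  exact Submodule.smul_mem _ _ (Submodule.subset_span ⟨l, by simpa [Nat.lt_succ_iff] using hl, rfl⟩)

theorem IsModel.translX (hS : IsGeneratorClass k S) (c : k)
    (h : IsModel k S u (hirzebruchExponents n a b) x y P Q) :
    IsModel k S u (hirzebruchExponents n a b) (x - algebraMap k F c) y P Q := by
  have := h.transform (E' := hirzebruchExponents n a b) (hS.swap _ _ (hS.sub_right (hS.swap _ _ h.mem_class) c)) one_ne_zero ?_
  · simpa using this
  rintro ⟨i, j⟩ ⟨h1, h2⟩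
  rw [one_mul]
  have h3 : Submodule.span k (Set.image (fun l => (x - algebraMap k F c) ^ l) {l | l ≤ i}) ≤
      (monomialSpan k (x - algebraMap k F c) y (hirzebruchExponents n a b)).comap
        (LinearMap.mulRight k (y ^ j)) := by
    rw [Submodule.span_le]
    rintro _ ⟨l, hl, rfl⟩
    refine monomial_mem_monomialSpan l j ⟨h1, ?_⟩
    have : (l : ℤ) ≤ i := by exact_mod_cast hl
    simp only at h2 ⊢
    linarith
  exact h3 (sub_add_pow_mem_span x c i)

theorem IsModel.translY (hS : IsGeneratorClass k S) (hn : 0 ≤ n) (c : k)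
    (h : IsModel k S u (hirzebruchExponents n a b) x y P Q) :
    IsModel k S u (hirzebruchExponents n a b) x (y - algebraMap k F c) P Q := by
  have := h.transform (E' := hirzebruchExponents n a b) (hS.sub_right h.mem_class c) one_ne_zero ?_
  · simpa using this
  rintro ⟨i, j⟩ ⟨h1, h2⟩
  rw [one_mul]
  have h3 : Submodule.span k (Set.image (fun l => (y - algebraMap k F c) ^ l) {l | l ≤ j}) ≤
      (monomialSpan k x (y - algebraMap k F c) (hirzebruchExponents n a b)).comap
        (LinearMap.mulLeft k (x ^ i)) := by
    rw [Submodule.span_le]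
    rintro _ ⟨l, hl, rfl⟩
    refine monomial_mem_monomialSpan i l ⟨le_trans hl h1, ?_⟩
    have : (l : ℤ) ≤ j := by exact_mod_cast hl
    simp only at h2 ⊢
    nlinarith
  exact h3 (sub_add_pow_mem_span y c j)

theorem jacobian_sub_left (D₁ D₂ : Derivation k F F) (x y : F) (c : k) :
    jacobian D₁ D₂ (x - algebraMap k F c) y = jacobian D₁ D₂ x y := by
  simp [jacobian]

theorem jacobian_sub_right (D₁ D₂ : Derivation k F F) (x y : F) (c : k) :
    jacobian D₁ D₂ x (y - algebraMap k F c) = jacobian D₁ D₂ x y := by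
  simp [jacobian]

theorem jacobian_inv_right (D₁ D₂ : Derivation k F F) (x y : F) :
    jacobian D₁ D₂ x y⁻¹ = -(y⁻¹ ^ 2 * jacobian D₁ D₂ x y) := by
  simp only [jacobian, Derivation.leibniz_inv, smul_eq_mul]
  ring

theorem jacobian_mul_zpow (D₁ D₂ : Derivation k F F) (x y : F) (n : ℤ) :
    jacobian D₁ D₂ x (y * x ^ n) = x ^ n * jacobian D₁ D₂ x y := by
  simp only [jacobian, Derivation.leibniz, Derivation.leibniz_zpow, smul_eq_mul, zsmul_eq_mul]
  ring

theorem jacobian_inv_mul_zpow (D₁ D₂ : Derivation k F F) (hx : x ≠ 0) (n : ℤ) :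
    jacobian D₁ D₂ x⁻¹ (y * x ^ (-n)) = -(x ^ (-(2 + n)) * jacobian D₁ D₂ x y) := by
  rw [jacobian_swap, jacobian_inv_right, jacobian_swap, jacobian_mul_zpow, neg_add, zpow_add₀ hx,
    zpow_neg _ 2, inv_pow]
  norm_cast
  ring

variable {ν : Valuation F (WithZero (Multiplicative ℤ))}

theorem MinimalFibreDegree.exists_aeval_lt_one (ha : MinimalFibreDegree k S u a) (ha1 : 1 ≤ a)
    (hν : ∀ c : k, c ≠ 0 → ν (algebraMap k F c) = 1) (hx : ν x ≤ 1) (hy : ν y ≤ 1)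
    (h : IsModel k S u (hirzebruchExponents n a b) x y P Q) (hP : ν P < 1) (hQ : ν Q < 1) :
    ∃ g : k[X], g ≠ 0 ∧ ν (aeval x g) < 1 := by
  obtain ⟨p, hp, hp'⟩ := mem_monomialSpan_iff.1 h.num_mem
  obtain ⟨q, hq, hq'⟩ := mem_monomialSpan_iff.1 h.den_mem
  have hdeg : ∀ p : k[X][X], (∀ i j, (p.coeff j).coeff i ≠ 0 → (i, j) ∈ hirzebruchExponents n a b) →
      p.natDegree ≤ a := by
    intro p hp
    rw [natDegree_le_iff_coeff_eq_zero]
    intro j hj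
    ext i
    by_contra hij
    exact absurd (hp i j hij).1 (not_le.2 hj)
  rcases exists_bezout_or_common_factor p q (hdeg p hp') (hdeg q hq') with
    ⟨A, B, d, hd, he⟩ | ⟨p', q', G, d, hd, h1, h2, h3, h4⟩
  · refine ⟨d, hd, ?_⟩
    have := congrArg (aevalAeval x y) he
    rw [map_add, map_mul, map_mul, hp, hq] at this
    have h1 : aevalAeval x y (C d) = aeval x d := by simp
    rw [← h1, ← this]
    refine ν.map_add_lt ?_ ?_
    · rw [map_mul]
      exact mul_lt_one_of_nonneg_of_lt_one_right (Valuation.aevalAeval_le_one hν hx hy _) zero_le hP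
    · rw [map_mul]
      exact mul_lt_one_of_nonneg_of_lt_one_right (Valuation.aevalAeval_le_one hν hx hy _) zero_le hQ
  · refine ⟨d, hd, ?_⟩
    by_cases hdx : aeval x d = 0
    · rw [hdx, map_zero]; exact zero_lt_one
    exfalso
    have e1 := congrArg (aevalAeval x y) h1
    have e2 := congrArg (aevalAeval x y) h2
    have e0 : aevalAeval x y (C d) = aeval x d := by simp
    rw [map_mul, map_mul, e0, hp] at e1
    rw [map_mul, map_mul, e0, hq] at e2
    have h5 : aevalAeval x y G * aevalAeval x y q' ≠ 0 := by
      rw [← e2]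
      exact mul_ne_zero hdx h.den_ne_zero
    obtain ⟨b₁, hb₁⟩ := exists_aevalAeval_mem_monomialSpan x y h3
    obtain ⟨b₂, hb₂⟩ := exists_aevalAeval_mem_monomialSpan x y h4
    refine ha (a - 1) (by omega) 0 (max b₁ b₂ : ℕ) x y _ _
      ⟨h.mem_class, hb₁ _ (le_max_left _ _), hb₂ _ (le_max_right _ _), right_ne_zero_of_mul h5, ?_⟩
    refine mul_left_cancel₀ (left_ne_zero_of_mul h5) ?_
    rw [← e1, ← h.mul_den, mul_left_comm, ← e2]
    ring

end Models

section Core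

open Polynomial

variable {k F : Type*} [Field k] [IsAlgClosed k] [Field F] [Algebra k F] {S : F → F → Prop} {u : F}
  {a : ℕ} {n b δ : ℤ} {x y P Q : F} {ν : Valuation F (WithZero (Multiplicative ℤ))}

theorem Valuation.exists_exp_neg_le {z : F} (hz : z ≠ 0) :
    ∃ N : ℕ, WithZero.exp (-(N : ℤ)) ≤ ν z := by
  refine ⟨(-(WithZero.log (ν z))).toNat, ?_⟩
  rw [← WithZero.exp_log ((ν.ne_zero_iff).2 hz), WithZero.exp_le_exp, WithZero.log_exp]
  omega

theorem MinimalDegree.exists_center_right (hS : IsGeneratorClass k S)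
    (hδ : MinimalDegree k S u a δ) (hb : 2 * b - n * a = δ)
    (hν : ∀ c : k, c ≠ 0 → ν (algebraMap k F c) = 1) (hn : 0 ≤ n ∨ ν y < 1)
    (hx0 : x ≠ 0) (hx : ν x < 1) (hy : ν y ≤ 1)
    (h : IsModel k S u (hirzebruchExponents n a b) x y P Q) (hP : ν P < 1) (hQ : ν Q < 1) :
    ∃ c : k, ν (y - algebraMap k F c) < 1 ∧
      IsModel k S u (hirzebruchExponents n a b) x (y - algebraMap k F c) P Q := by
  by_cases hy1 : ν y < 1
  · exact ⟨0, by simpa using hy1, by simpa using h⟩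
  replace hn := hn.resolve_right hy1
  have key : ∀ p : k[X][X], ν (aevalAeval x y p) < 1 → p.map constantCoeff ≠ 0 →
      ∃ c : k, ν (y - algebraMap k F c) < 1 := by
    intro p hp hp0
    have := ν.map_sub_lt hp (Valuation.aevalAeval_sub_lt_one hν hx hy p)
    rw [sub_sub_cancel] at this
    obtain ⟨c, -, hc⟩ := Valuation.exists_root_sub_lt_one hν hy hp0 this
    exact ⟨c, hc⟩
  suffices ∃ c : k, ν (y - algebraMap k F c) < 1 by
    obtain ⟨c, hc⟩ := this
    exact ⟨c, hc, h.translY hS hn c⟩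
  obtain ⟨p, hp, hp'⟩ := mem_monomialSpan_iff.1 h.num_mem
  obtain ⟨q, hq, hq'⟩ := mem_monomialSpan_iff.1 h.den_mem
  by_contra hcon
  have hp0 : p.map constantCoeff = 0 := by
    by_contra h0
    exact hcon (key p (by rwa [hp]) h0)
  have hq0 : q.map constantCoeff = 0 := by
    by_contra h0
    exact hcon (key q (by rwa [hq]) h0)
  have hsub : ∀ p : k[X][X], p.map constantCoeff = 0 → ∀ i j, (p.coeff j).coeff i ≠ 0 → 1 ≤ i := by
    intro p hp i j hij
    by_contra hi
    have := congrArg (fun f => coeff f j) hp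
    simp only [coeff_map, constantCoeff_apply, coeff_zero] at this
    rw [show i = 0 by omega] at hij
    exact hij this
  exact hδ.not_dvd hb hx0 ⟨h.mem_class,
    mem_monomialSpan_iff.2 ⟨p, hp, fun i j hij => ⟨hp' i j hij, hsub p hp0 i j hij⟩⟩,
    mem_monomialSpan_iff.2 ⟨q, hq, fun i j hij => ⟨hq' i j hij, hsub q hq0 i j hij⟩⟩,
    h.den_ne_zero, h.mul_den⟩

/-- The local inequality of Noether and Fano, at a place centred on an affine chart. -/
theorem exists_jacobian_le_of_le_one (hS : IsGeneratorClass k S) (D₁ D₂ : Derivation k F F)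
    (hD : ∀ x y : F, k⟮x, y⟯ = ⊤ → jacobian D₁ D₂ x y ≠ 0)
    (ha : MinimalFibreDegree k S u a) (ha1 : 1 ≤ a)
    (hδ : MinimalDegree k S u a δ) (hb : 2 * b - n * a = δ)
    (hν : ∀ c : k, c ≠ 0 → ν (algebraMap k F c) = 1) (hu : ν u = 1) {l r : ℕ}
    (hm : ∀ (m : ℕ) (x y P Q : F),
      IsModel k S u (hirzebruchExponents n a b ∩ {e | m ≤ e.1 + e.2}) x y P Q → l * m ≤ r)
    (hn : 0 ≤ n ∨ ν y < 1) (hx : ν x ≤ 1) (hy : ν y ≤ 1)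
    (h : IsModel k S u (hirzebruchExponents n a b) x y P Q) :
    ∃ p₁ p₂ : F, ν p₁ ≤ 1 ∧ ν p₂ ≤ 1 ∧
      ν (jacobian D₁ D₂ x y) ^ r ≤ ν Q ^ l * ν (jacobian D₁ D₂ p₁ p₂) ^ r := by
  have hPQ : ν P = ν Q := by rw [← h.mul_den, map_mul, hu, one_mul]
  have hQ1 : ν Q ≤ 1 := by
    obtain ⟨q, hq, -⟩ := mem_monomialSpan_iff.1 h.den_mem
    rw [← hq]
    exact Valuation.aevalAeval_le_one hν hx hy q
  rcases hQ1.eq_or_lt with hQ | hQ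
  · exact ⟨x, y, hx, hy, by rw [hQ, one_pow, one_mul]⟩
  obtain ⟨g, hg, hgx⟩ := ha.exists_aeval_lt_one ha1 hν hx hy h (hPQ ▸ hQ) hQ
  obtain ⟨c, -, hc⟩ := Valuation.exists_root_sub_lt_one hν hx hg hgx
  replace h := h.translX hS c
  obtain ⟨d, hd, h1⟩ := hδ.exists_center_right hS hb hν hn (hS.ne_zero hD h.mem_class).1 hc hy h
    (hPQ ▸ hQ) hQ
  rw [← jacobian_sub_left D₁ D₂ x y c, ← jacobian_sub_right D₁ D₂ _ y d]
  set s := x - algebraMap k F c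
  set t := y - algebraMap k F d
  obtain ⟨p, hp, hp'⟩ := mem_monomialSpan_iff.1 h1.num_mem
  obtain ⟨q, hq, hq'⟩ := mem_monomialSpan_iff.1 h1.den_mem
  have hq0 : q ≠ 0 := by
    rintro rfl
    exact h.den_ne_zero (by rw [← hq, map_zero])
  have hex : ∃ m : ℕ, ∃ R : k[X][X], (R = p ∨ R = q) ∧
      ∃ i j, (R.coeff j).coeff i ≠ 0 ∧ i + j ≤ m := by
    obtain ⟨j, hj⟩ : ∃ j, q.coeff j ≠ 0 := by
      by_contra! h0
      exact hq0 (Polynomial.ext fun j => by rw [h0 j, coeff_zero])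
    obtain ⟨i, hi⟩ : ∃ i, (q.coeff j).coeff i ≠ 0 := by
      by_contra! h0
      exact hj (Polynomial.ext fun j => by rw [h0 j, coeff_zero])
    exact ⟨i + j, q, Or.inr rfl, i, j, hi, le_rfl⟩
  classical
  have hmin : ∀ R : k[X][X], (R = p ∨ R = q) → ∀ i j, (R.coeff j).coeff i ≠ 0 →
      Nat.find hex ≤ i + j := fun R hR i j hij => Nat.find_min' hex ⟨R, hR, i, j, hij, le_rfl⟩
  have hlr := hm (Nat.find hex) s t P Q ⟨h1.mem_class,
    mem_monomialSpan_iff.2 ⟨p, hp, fun i j hij => ⟨hp' i j hij, hmin p (Or.inl rfl) i j hij⟩⟩,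
    mem_monomialSpan_iff.2 ⟨q, hq, fun i j hij => ⟨hq' i j hij, hmin q (Or.inr rfl) i j hij⟩⟩,
    h1.den_ne_zero, h1.mul_den⟩
  obtain ⟨R, hR, hRm⟩ := Nat.find_spec hex
  have hRQ : ν (aevalAeval s t R) = ν Q := by
    rcases hR with rfl | rfl
    · rw [hp, hPQ]
    · rw [hq]
  obtain ⟨N, hN⟩ := Valuation.exists_exp_neg_le (ν := ν) h.den_ne_zero
  obtain ⟨p₁, p₂, h2, h3, h4, h5⟩ := exists_jacobian_le_of_multiplicity_le hν D₁ D₂ N _ s t R hc hd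
    (hD _ _ (hS.adjoin_eq_top _ _ h1.mem_class)) hRm (by rwa [hRQ])
  refine ⟨p₁, p₂, h2, h3, ?_⟩
  rw [hRQ] at h5
  obtain ⟨w, rfl⟩ := Nat.exists_eq_add_of_le hlr
  rw [pow_add, pow_add, ← mul_assoc]
  refine mul_le_mul' ?_ (pow_le_pow_left' h4 w)
  rw [mul_comm l, pow_mul, pow_mul, ← mul_pow]
  exact pow_le_pow_left' h5 l

end Core

section NoetherFano

open Polynomial

variable {k F : Type*} [Field k] [Field F] [Algebra k F] {S : F → F → Prop} {u : F}
  {a : ℕ} {n b δ : ℤ} {x y P Q : F} {ν : Valuation F (WithZero (Multiplicative ℤ))}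

theorem WithZero.zpow_mul_le_of_one_lt {X A B : WithZero (Multiplicative ℤ)} {e f : ℤ}
    (hX : 1 < X) (hef : e ≤ f) (h : X ^ (-e) * A ≤ X ^ (-f) * B) : A ≤ B := by
  have hX0 : X ≠ 0 := (zero_lt_one.trans hX).ne'
  have h1 : X ^ e * (X ^ (-e) * A) ≤ X ^ f * (X ^ (-f) * B) :=
    mul_le_mul' (zpow_le_zpow_right₀ hX.le hef) h
  rwa [← mul_assoc, ← mul_assoc, ← zpow_add₀ hX0, ← zpow_add₀ hX0, add_neg_cancel,
    add_neg_cancel, zpow_zero, one_mul, one_mul] at h1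

theorem exists_jacobian_le_of_left_le_one [IsAlgClosed k] (hS : IsGeneratorClass k S)
    (D₁ D₂ : Derivation k F F)
    (hD : ∀ x y : F, k⟮x, y⟯ = ⊤ → jacobian D₁ D₂ x y ≠ 0)
    (ha : MinimalFibreDegree k S u a) (ha1 : 1 ≤ a)
    (hδ : MinimalDegree k S u a δ) (hb : 2 * b - n * a = δ)
    (hν : ∀ c : k, c ≠ 0 → ν (algebraMap k F c) = 1) (hu : ν u = 1) {l r : ℕ}
    (hm : ∀ (m : ℕ) (x y P Q : F),
      IsModel k S u (hirzebruchExponents n a b ∩ {e | m ≤ e.1 + e.2}) x y P Q → l * m ≤ r)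
    (hm' : ∀ (m : ℕ) (x y P Q : F),
      IsModel k S u (hirzebruchExponents (-n) a (b - n * a) ∩ {e | m ≤ e.1 + e.2}) x y P Q →
        l * m ≤ r) (hr : 2 * r ≤ l * a)
    (hn : 0 ≤ n) (hx : ν x ≤ 1) (h : IsModel k S u (hirzebruchExponents n a b) x y P Q) :
    ∃ p₁ p₂ : F, ν p₁ ≤ 1 ∧ ν p₂ ≤ 1 ∧
      ν (jacobian D₁ D₂ x y) ^ r ≤ ν Q ^ l * ν (jacobian D₁ D₂ p₁ p₂) ^ r := by
  rcases le_or_gt (ν y) 1 with hy | hy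
  · exact exists_jacobian_le_of_le_one hS D₁ D₂ hD ha ha1 hδ hb hν hu hm (Or.inl hn) hx hy h
  have hy0 : y ≠ 0 := (hS.ne_zero hD h.mem_class).2
  have hy1 : ν y⁻¹ < 1 := by
    rw [map_inv₀]
    exact inv_lt_one_of_one_lt₀ hy
  obtain ⟨p₁, p₂, h1, h2, h3⟩ := exists_jacobian_le_of_le_one hS D₁ D₂ hD ha ha1 hδ
    (by linarith) hν hu hm' (Or.inr hy1) hx hy1.le (h.invY hS hy0)
  refine ⟨p₁, p₂, h1, h2, WithZero.zpow_mul_le_of_one_lt (e := (2 * r : ℕ)) (f := (l * a : ℕ)) hy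
    (by exact_mod_cast hr) ?_⟩
  rw [jacobian_inv_right] at h3
  simp only [Valuation.map_neg, map_mul, map_pow, map_inv₀, mul_pow] at h3
  rw [zpow_neg, zpow_neg, zpow_natCast, zpow_natCast, pow_mul, mul_comm l a, pow_mul, ← inv_pow,
    ← inv_pow, ← inv_pow, ← mul_assoc]
  simpa only [inv_pow] using h3

theorem exists_jacobian_le [IsAlgClosed k] (hS : IsGeneratorClass k S)
    (D₁ D₂ : Derivation k F F)
    (hD : ∀ x y : F, k⟮x, y⟯ = ⊤ → jacobian D₁ D₂ x y ≠ 0)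
    (ha : MinimalFibreDegree k S u a) (ha1 : 1 ≤ a)
    (hδ : MinimalDegree k S u a δ) (hb : 2 * b - n * a = δ)
    (hν : ∀ c : k, c ≠ 0 → ν (algebraMap k F c) = 1) (hu : ν u = 1) {l r : ℕ}
    (hm : ∀ (m : ℕ) (x y P Q : F),
      IsModel k S u (hirzebruchExponents n a b ∩ {e | m ≤ e.1 + e.2}) x y P Q → l * m ≤ r)
    (hm' : ∀ (m : ℕ) (x y P Q : F),
      IsModel k S u (hirzebruchExponents (-n) a (b - n * a) ∩ {e | m ≤ e.1 + e.2}) x y P Q →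
        l * m ≤ r) (hr : 2 * r ≤ l * a) (hr' : (2 + n) * r ≤ l * b)
    (hn : 0 ≤ n) (h : IsModel k S u (hirzebruchExponents n a b) x y P Q) :
    ∃ p₁ p₂ : F, ν p₁ ≤ 1 ∧ ν p₂ ≤ 1 ∧
      ν (jacobian D₁ D₂ x y) ^ r ≤ ν Q ^ l * ν (jacobian D₁ D₂ p₁ p₂) ^ r := by
  rcases le_or_gt (ν x) 1 with hx | hx
  · exact exists_jacobian_le_of_left_le_one hS D₁ D₂ hD ha ha1 hδ hb hν hu hm hm' hr hn hx h
  have hx0 : x ≠ 0 := (hS.ne_zero hD h.mem_class).1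
  have hx1 : ν x⁻¹ ≤ 1 := by
    rw [map_inv₀]
    exact (inv_lt_one_of_one_lt₀ hx).le
  obtain ⟨p₁, p₂, h1, h2, h3⟩ := exists_jacobian_le_of_left_le_one hS D₁ D₂ hD ha ha1 hδ hb hν hu
    hm hm' hr hn hx1 (h.invX hS hx0)
  refine ⟨p₁, p₂, h1, h2, WithZero.zpow_mul_le_of_one_lt hx hr' ?_⟩
  rw [jacobian_inv_mul_zpow _ _ hx0] at h3
  simp only [Valuation.map_neg, map_mul, map_zpow₀, mul_pow] at h3
  rw [← neg_mul, zpow_mul, zpow_natCast, mul_comm (l : ℤ) b, ← neg_mul, zpow_mul, zpow_natCast,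
    ← mul_assoc]
  exact h3

/-- Numerical part of the inequality of Noether and Fano. -/
theorem MinimalDegree.exists_weights (hS : IsGeneratorClass k S) (hS0 : ∀ x y, S x y → x ≠ 0 ∧ y ≠ 0)
    (ha : MinimalFibreDegree k S u a) (ha1 : 1 ≤ a)
    (hδ : MinimalDegree k S u a δ) (hb : 2 * b - n * a = δ) (hn : 0 ≤ n)
    (h : IsModel k S u (hirzebruchExponents n a b) x y P Q) :
    ∃ l r : ℕ, 1 ≤ r ∧ (∀ (m : ℕ) (x y P Q : F),
      IsModel k S u (hirzebruchExponents n a b ∩ {e | m ≤ e.1 + e.2}) x y P Q → l * m ≤ r) ∧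
    (∀ (m : ℕ) (x y P Q : F),
      IsModel k S u (hirzebruchExponents (-n) a (b - n * a) ∩ {e | m ≤ e.1 + e.2}) x y P Q →
        l * m ≤ r) ∧ 2 * r ≤ l * a ∧ (2 + n) * r ≤ l * b := by
  have hna := ha.mul_le ha1 h
  have hb' : 2 * (b - n * a) - -n * a = δ := by linarith
  have ha2 : (1 : ℤ) ≤ a := by exact_mod_cast ha1
  by_cases hcase : (2 + n) * a ≤ 2 * b
  · refine ⟨2, a, ha1, fun m x y P Q h => ?_, fun m x y P Q h => ?_, le_rfl, by exact_mod_cast hcase⟩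
    · exact hδ.multiplicity_le hb hS (hS0 _ _ h.mem_class).1 h
    · exact hδ.multiplicity_le hb' hS (hS0 _ _ h.mem_class).1 h
  obtain rfl : n = 1 := by
    rcases hn.eq_or_lt with rfl | hn
    · have := ha.le_of_zero ha1 hS h
      exact absurd (by linarith) hcase
    · by_contra hn1
      have : 2 ≤ n := by omega
      refine hcase ?_
      nlinarith
  refine ⟨3, b.toNat, by omega, fun m x y P Q h => ?_, fun m x y P Q h => ?_, by omega, ?_⟩
  · have h1 := hδ.multiplicity_le hb hS (hS0 _ _ h.mem_class).1 h
    have h2 := ha.multiplicity_le ha1 hS (hS0 _ _ h.mem_class).1 h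
    omega
  · have h1 := hδ.multiplicity_le hb' hS (hS0 _ _ h.mem_class).1 h
    have h2 := ha.multiplicity_le_neg ha1 (hS0 _ _ h.mem_class).2 h
    omega
  · rw [Int.toNat_of_nonneg (by omega)]
    norm_num

theorem MinimalFibreDegree.exists_minimalDegree (hS : IsGeneratorClass k S)
    (hS0 : ∀ x y, S x y → x ≠ 0 ∧ y ≠ 0)
    (ha : MinimalFibreDegree k S u a) (ha1 : 1 ≤ a)
    (h : IsModel k S u (hirzebruchExponents n a b) x y P Q) :
    ∃ (δ n b : ℤ) (x y P Q : F), IsModel k S u (hirzebruchExponents n a b) x y P Q ∧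
      MinimalDegree k S u a δ ∧ 2 * b - n * a = δ ∧ 0 ≤ n := by
  have hpos : ∀ (n b : ℤ) (x y P Q : F), IsModel k S u (hirzebruchExponents n a b) x y P Q →
      0 ≤ 2 * b - n * a := by
    intro n b x y P Q h
    have h1 := ha.nonneg ha1 (hS0 _ _ h.mem_class).2 h
    have h2 := ha.mul_le ha1 h
    linarith
  have hex : ∃ δ : ℕ, ∃ (n b : ℤ) (x y P Q : F),
      IsModel k S u (hirzebruchExponents n a b) x y P Q ∧ 2 * b - n * a = δ :=
    ⟨(2 * b - n * a).toNat, n, b, x, y, P, Q, h, (Int.toNat_of_nonneg (hpos _ _ _ _ _ _ h)).symm⟩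
  classical
  have hmin : MinimalDegree k S u a (Nat.find hex) := by
    intro n b x y P Q h
    have h1 := hpos _ _ _ _ _ _ h
    have := Nat.find_min' hex ⟨n, b, x, y, P, Q, h, (Int.toNat_of_nonneg h1).symm⟩
    omega
  obtain ⟨n, b, x, y, P, Q, h, he⟩ := Nat.find_spec hex
  rcases le_or_gt 0 n with hn | hn
  · exact ⟨_, n, b, x, y, P, Q, h, hmin, he, hn⟩
  · exact ⟨_, _, _, _, _, _, _, h.invY hS (hS0 _ _ h.mem_class).2, hmin, by linarith, by linarith⟩

theorem exists_isModel (hS : IsGeneratorClass k S) (h : S x y) (hu : u ≠ 0) :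
    ∃ (a : ℕ) (n b : ℤ) (P Q : F), IsModel k S u (hirzebruchExponents n a b) x y P Q := by
  have hmem : u ∈ k⟮x, y⟯ := by rw [hS.adjoin_eq_top x y h]; trivial
  obtain ⟨r, hr, s, hs, he⟩ := mem_adjoin_iff_div.1 hmem
  have hle : Algebra.adjoin k {x, y} ≤ (aevalAeval x y : k[X][X] →ₐ[k] F).range := by
    rw [Algebra.adjoin_le_iff]
    rintro z (rfl | rfl)
    · exact ⟨C X, by simp⟩
    · exact ⟨X, by simp⟩
  obtain ⟨p, hp⟩ := hle hr
  obtain ⟨q, hq⟩ := hle hs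
  have hs0 : s ≠ 0 := by
    rintro rfl
    exact hu (by rw [he, div_zero])
  obtain ⟨b₁, hb₁⟩ := exists_aevalAeval_mem_monomialSpan x y (le_max_left p.natDegree q.natDegree)
  obtain ⟨b₂, hb₂⟩ := exists_aevalAeval_mem_monomialSpan x y (le_max_right p.natDegree q.natDegree)
  refine ⟨max p.natDegree q.natDegree, 0, (max b₁ b₂ : ℕ), r, s, h, ?_, ?_, hs0, ?_⟩
  · rw [← hp]; exact hb₁ _ (le_max_left _ _)
  · rw [← hq]; exact hb₂ _ (le_max_right _ _)
  · rw [he, div_mul_cancel₀ _ hs0]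

theorem IsModel.mem_adjoin (h : IsModel k S u (hirzebruchExponents n 0 b) x y P Q) : u ∈ k⟮x⟯ := by
  have hle : monomialSpan k x y (hirzebruchExponents n 0 b) ≤ k⟮x⟯.toSubalgebra.toSubmodule := by
    rw [monomialSpan, Submodule.span_le]
    rintro _ ⟨⟨i, j⟩, ⟨h1, -⟩, rfl⟩
    obtain rfl : j = 0 := by simpa using h1
    simpa using pow_mem (mem_adjoin_simple_self k x) i
  rw [eq_div_of_mul_eq h.den_ne_zero h.mul_den]
  exact div_mem (hle h.num_mem) (hle h.den_mem)

end NoetherFano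

/-- Every generator class contains a pair whose first element determines the first coordinate. -/
theorem exists_coord_mem_adjoin (k : Type u) [Field k] [IsAlgClosed k]
    {S : CremonaField k → CremonaField k → Prop} (hS : IsGeneratorClass k S)
    {x₀ y₀ : CremonaField k} (h₀ : S x₀ y₀) : ∃ x y, S x y ∧ coord k 0 ∈ k⟮x⟯ := by
  obtain ⟨D₁, D₂, hD, hval⟩ := exists_jacobian_valuation k
  have hS0 : ∀ x y, S x y → x ≠ 0 ∧ y ≠ 0 := fun x y h => hS.ne_zero hD h
  have hu : coord k 0 ≠ 0 := by
    have := hD _ _ (adjoin_coord_eq_top k)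
    intro h
    simp [h, jacobian] at this
  have hex : ∃ (a : ℕ) (n b : ℤ) (x y P Q : CremonaField k),
      IsModel k S (coord k 0) (hirzebruchExponents n a b) x y P Q := by
    obtain ⟨a, n, b, P, Q, h⟩ := exists_isModel hS h₀ hu
    exact ⟨a, n, b, _, _, P, Q, h⟩
  classical
  have ha : MinimalFibreDegree k S (coord k 0) (Nat.find hex) := fun a' ha' n b x y P Q h =>
    Nat.find_min hex ha' ⟨n, b, x, y, P, Q, h⟩
  obtain ⟨n, b, x, y, P, Q, h⟩ := Nat.find_spec hex
  generalize Nat.find hex = a at ha h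
  rcases Nat.eq_zero_or_pos a with rfl | ha1
  · exact ⟨x, y, h.mem_class, h.mem_adjoin⟩
  exfalso
  obtain ⟨δ, n, b, x, y, P, Q, h, hδ, hb, hn⟩ := ha.exists_minimalDegree hS hS0 ha1 h
  obtain ⟨l, r, hr1, hm, hm', hr, hr'⟩ := hδ.exists_weights hS hS0 ha ha1 hb hn h
  have hJ := hD x y (hS.adjoin_eq_top x y h.mem_class)
  obtain ⟨ν, hν, hlt⟩ := hval (jacobian D₁ D₂ x y ^ r / Q ^ l)
    (div_ne_zero (pow_ne_zero _ hJ) (pow_ne_zero _ h.den_ne_zero)) r hr1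
  obtain ⟨p₁, p₂, h1, h2, h3⟩ := exists_jacobian_le hS D₁ D₂ hD ha ha1 hδ hb
    (fun c hc => hν _ (IntermediateField.algebraMap_mem _ c) ((map_ne_zero _).2 hc))
    (hν _ (mem_adjoin_simple_self k _) hu) hm hm' hr hr' hn h
  have hQ : ν Q ^ l ≠ 0 := pow_ne_zero _ (ν.ne_zero_iff.2 h.den_ne_zero)
  have h4 := hlt p₁ p₂ h1 h2
  rw [map_div₀, map_pow, map_pow, lt_div_iff₀ (zero_lt_iff.2 hQ)] at h4
  rw [mul_comm] at h3
  exact absurd h3 (not_le.2 h4)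

/-- A commuting family of endomorphisms preserving a nonzero finite-dimensional subspace
has a common eigenvector in it. -/
theorem Module.End.exists_common_eigenvector {K E ι : Type*} [Field K] [IsAlgClosed K]
    [AddCommGroup E] [Module K E] (T : ι → Module.End K E) (hT : ∀ i j, Commute (T i) (T j)) :
    ∀ (d : ℕ) (W : Submodule K E), FiniteDimensional K W → Module.finrank K W = d → W ≠ ⊥ →
      (∀ i, ∀ w ∈ W, T i w ∈ W) → ∃ w ∈ W, w ≠ 0 ∧ ∀ i, ∃ c : K, T i w = c • w := by
  intro d
  induction d using Nat.strong_induction_on with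
  | _ d ih =>
    intro W hfin hd hW hTW
    by_cases hsc : ∀ i, ∃ c : K, ∀ w ∈ W, T i w = c • w
    · obtain ⟨w, hw, hw0⟩ := W.ne_bot_iff.1 hW
      exact ⟨w, hw, hw0, fun i => (hsc i).imp fun c hc => hc w hw⟩
    push Not at hsc
    obtain ⟨i, hi⟩ := hsc
    have : Nontrivial W := Submodule.nontrivial_iff_ne_bot.2 hW
    obtain ⟨c, hc⟩ := Module.End.exists_eigenvalue ((T i).restrict (hTW i))
    obtain ⟨⟨v, hvW⟩, hv⟩ := hc.exists_hasEigenvector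
    have hv0 : v ≠ 0 := fun h => hv.2 (Subtype.ext h)
    have hTv : T i v = c • v := congrArg Subtype.val hv.apply_eq_smul
    obtain ⟨w, hw, hwc⟩ := hi c
    let U := W ⊓ LinearMap.ker (T i - c • LinearMap.id)
    have hUW : U < W := by
      refine lt_of_le_of_ne inf_le_left fun h => hwc ?_
      rw [← h] at hw
      have := LinearMap.mem_ker.1 hw.2
      rwa [LinearMap.sub_apply, sub_eq_zero] at this
    have hfinU : FiniteDimensional K U := Submodule.finiteDimensional_of_le hUW.le
    obtain ⟨z, hz, hz0, hzT⟩ := ih _ (hd ▸ Submodule.finrank_lt_finrank_of_lt hUW) U hfinU rfl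
      (U.ne_bot_iff.2 ⟨v, ⟨hvW, by simp [hTv]⟩, hv0⟩) (fun j w hw => ⟨hTW j w hw.1, by
        have h1 : T i w = c • w := by
          have := LinearMap.mem_ker.1 hw.2
          rwa [LinearMap.sub_apply, sub_eq_zero] at this
        have h2 : T i (T j w) = T j (T i w) := LinearMap.congr_fun (hT i j).eq w
        simp [h2, h1]⟩)
    exact ⟨z, hz.1, hz0, hzT⟩

section InvariantFunctions

variable {L K : Type*} [Field L] [Field K] (W : Submodule K (L → K))
  [FiniteDimensional K W]

theorem not_injective_of_linearIndependent {ι E : Type*} [Infinite ι] [AddCommGroup E] [Module K E]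
    (W : Submodule K E) [FiniteDimensional K W] {J : Type*} {e : J → E}
    (he : LinearIndependent K e) {f : ι → J} (hf : ∀ i, e (f i) ∈ W) : ¬ Function.Injective f := by
  intro hinj
  have h1 : LinearIndependent K fun i => (⟨e (f i), hf i⟩ : W) := by
    refine LinearIndependent.of_comp W.subtype ?_
    exact he.comp f hinj
  exact not_finite_iff_infinite.2 ‹Infinite ι› h1.finite

theorem character_eq_one_of_mem [Infinite L] (hscal : ∀ h : L, h ≠ 0 → ∀ g ∈ W, (fun x => g (h * x)) ∈ W)
    (χ : L → K) (hχ0 : χ 0 = 1) (hχ : ∀ x y, χ (x + y) = χ x * χ y) (hmem : χ ∈ W) (x : L) :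
    χ x = 1 := by
  have : Infinite ({0}ᶜ : Set L) := (Set.finite_singleton 0).infinite_compl.to_subtype
  let f : ({0}ᶜ : Set L) → Multiplicative L →* K := fun h =>
    { toFun := fun x => χ ((h : L) * x.toAdd)
      map_one' := by simp [hχ0]
      map_mul' := fun x y => by simp [mul_add, hχ] }
  have h1 : ¬ Function.Injective f := by
    refine not_injective_of_linearIndependent W (E := L → K) (J := Multiplicative L →* K)
      (e := fun g x => g (Multiplicative.ofAdd x)) ?_ fun h => ?_
    · exact linearIndependent_monoidHom (Multiplicative L) K
    · exact hscal h h.2 χ hmem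
  rw [Function.not_injective_iff] at h1
  obtain ⟨h, h', he, hne⟩ := h1
  have hd : (h : L) - h' ≠ 0 := sub_ne_zero.2 fun h0 => hne (Subtype.ext h0)
  have h2 : ∀ z : L, χ (((h : L) - h') * z) = 1 := by
    intro z
    have h3 : χ (h * z) = χ (h' * z) := DFunLike.congr_fun he (Multiplicative.ofAdd z)
    have h4 : χ (h' * z) ≠ 0 := by
      intro h0
      have := hχ (h' * z) (-(h' * z))
      rw [add_neg_cancel, hχ0, h0, zero_mul] at this
      exact one_ne_zero this
    have h5 : χ (h * z) = χ (((h : L) - h') * z) * χ (h' * z) := by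
      rw [← hχ]; congr 1; ring
    rw [h3] at h5
    exact (mul_right_cancel₀ h4 (by rw [one_mul]; exact h5)).symm
  have := h2 (((h : L) - h')⁻¹ * x)
  rwa [mul_inv_cancel_left₀ hd] at this

variable [IsAlgClosed K]

theorem additive_eq_zero_of_mem (hscal : ∀ h : L, h ≠ 0 → ∀ g ∈ W, (fun x => g (h * x)) ∈ W)
    {ι : Type*} [Infinite ι] (σ : ι → L →+* L) (hσ : Function.Injective σ)
    (hσW : ∀ i, ∀ g ∈ W, g ∘ σ i ∈ W) (g : L → K) (hadd : ∀ x y, g (x + y) = g x + g y)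
    (hmem : g ∈ W) : g = 0 := by
  by_contra hg
  let A : Submodule K (L → K) :=
    { carrier := {g | ∀ x y, g (x + y) = g x + g y}
      add_mem' := fun {f g} hf hg x y => by
        simp only [Set.mem_ofPred_eq, Pi.add_apply] at *
        rw [hf, hg]; ring
      zero_mem' := fun x y => by simp
      smul_mem' := fun c f hf x y => by
        simp only [Set.mem_ofPred_eq, Pi.smul_apply, smul_eq_mul] at *
        rw [hf]; ring }
  have hfin : FiniteDimensional K ↥(W ⊓ A) := Submodule.finiteDimensional_of_le inf_le_left
  obtain ⟨e, ⟨heW, heA⟩, he0, he⟩ := Module.End.exists_common_eigenvector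
    (fun h : Lˣ => LinearMap.funLeft K K fun x : L => (h : L) * x)
    (fun h h' => by
      ext f x
      simp [LinearMap.funLeft_apply, mul_left_comm]) _ (W ⊓ A) hfin rfl
    (Submodule.ne_bot_iff _ |>.2 ⟨g, ⟨hmem, hadd⟩, hg⟩)
    (fun h w hw => ⟨hscal h h.ne_zero w hw.1, fun x y => by
      simp only [LinearMap.funLeft_apply, mul_add]
      exact hw.2 _ _⟩)
  choose μ hμ using he
  have hμ' : ∀ (h : Lˣ) x, e (h * x) = μ h * e x := fun h x => congrFun (hμ h) x
  have hz : e 0 = 0 := by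
    have := heA 0 0
    rwa [add_zero, left_eq_add] at this
  have h1 : e 1 ≠ 0 := by
    intro h1
    refine he0 (funext fun x => ?_)
    by_cases hx : x = 0
    · rw [hx, hz]; rfl
    · have := hμ' (Units.mk0 x hx) 1
      rwa [mul_one, h1, mul_zero] at this
  have hmul : ∀ x y, (e 1)⁻¹ * e (x * y) = ((e 1)⁻¹ * e x) * ((e 1)⁻¹ * e y) := by
    intro x y
    by_cases hx : x = 0
    · rw [hx, zero_mul, hz]; ring
    · have h2 := hμ' (Units.mk0 x hx) y
      have h3 := hμ' (Units.mk0 x hx) 1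
      rw [Units.val_mk0] at h2 h3
      rw [mul_one] at h3
      rw [h2, h3]
      field_simp
  let ℓ : L →+* K :=
    { toFun := fun x => (e 1)⁻¹ * e x
      map_one' := inv_mul_cancel₀ h1
      map_mul' := hmul
      map_zero' := by rw [hz, mul_zero]
      map_add' := fun x y => by rw [heA x y, mul_add] }
  refine not_injective_of_linearIndependent W (E := L → K) (J := L →* K)
    (e := fun g x => g x) (linearIndependent_monoidHom L K)
    (f := fun i => ((ℓ.comp (σ i) : L →+* K) : L →* K)) (fun i => ?_) ?_
  · exact W.smul_mem (e 1)⁻¹ (hσW i e heW)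
  · intro i j hij
    exact hσ (RingHom.ext fun x => ℓ.injective (DFunLike.congr_fun hij x))

/-- A finite-dimensional space of functions on an infinite field which is invariant under
translations, homotheties and infinitely many field endomorphisms consists of constants. -/
theorem apply_eq_apply_of_mem_of_invariant [Infinite L] (hone : (fun _ => 1) ∈ W)
    (htrans : ∀ t : L, ∀ g ∈ W, (fun x => g (x + t)) ∈ W)
    (hscal : ∀ h : L, h ≠ 0 → ∀ g ∈ W, (fun x => g (h * x)) ∈ W)
    {ι : Type*} [Infinite ι] (σ : ι → L →+* L) (hσ : Function.Injective σ)
    (hσW : ∀ i, ∀ g ∈ W, g ∘ σ i ∈ W) (g : L → K) (hg : g ∈ W) (x y : L) : g x = g y := by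
  let C : Submodule K (L → K) := K ∙ (fun _ => (1 : K))
  have hC : ∀ f, f ∈ C ↔ ∃ c : K, ∀ x, f x = c := by
    intro f
    rw [Submodule.mem_span_singleton]
    constructor
    · rintro ⟨c, rfl⟩
      exact ⟨c, fun x => by simp⟩
    · rintro ⟨c, hc⟩
      exact ⟨c, funext fun x => by simp [hc]⟩
  suffices hWC : W ≤ C by
    obtain ⟨c, hc⟩ := (hC g).1 (hWC hg)
    rw [hc, hc]
  by_contra hWC
  let τ : L → Module.End K (L → K) := fun t => LinearMap.funLeft K K fun x : L => x + t
  have hτC : ∀ t, C ≤ C.comap (τ t) := by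
    intro t f hf
    obtain ⟨c, hc⟩ := (hC f).1 hf
    exact (hC _).2 ⟨c, fun x => hc _⟩
  have hfin : FiniteDimensional K (W.map C.mkQ) := inferInstance
  obtain ⟨_, ⟨e, heW, rfl⟩, he0, he⟩ := Module.End.exists_common_eigenvector
    (fun t : L => C.mapQ C (τ t) (hτC t))
    (fun s t => by
      refine LinearMap.ext fun f => ?_
      obtain ⟨f, rfl⟩ := C.mkQ_surjective f
      simp only [Module.End.mul_apply, Submodule.mkQ_apply, Submodule.mapQ_apply]
      congr 1
      funext x
      simp [τ, LinearMap.funLeft_apply, add_right_comm]) _ (W.map C.mkQ) hfin rfl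
    (by
      intro h
      rw [← LinearMap.le_ker_iff_map, Submodule.ker_mkQ] at h
      exact hWC h)
    (by
      rintro t _ ⟨w, hw, rfl⟩
      exact ⟨τ t w, htrans t w hw, rfl⟩)
  choose χ hχ using he
  have hconst : ∀ t, ∃ c, ∀ x, e (x + t) - χ t * e x = c := by
    intro t
    refine (hC fun x => e (x + t) - χ t * e x).1 ?_
    have := hχ t
    rw [Submodule.mkQ_apply, Submodule.mapQ_apply, ← Submodule.Quotient.mk_smul,
      Submodule.Quotient.eq] at this
    exact this
  let f : L → K := fun x => e x - e 0
  have hfW : f ∈ W := by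
    have : f = e - e 0 • (fun _ => 1) := by
      funext x; simp [f]
    rw [this]
    exact W.sub_mem heW (W.smul_mem _ hone)
  have hf0 : f 0 = 0 := sub_self _
  have hf : ∀ x t, f (x + t) = χ t * f x + f t := by
    intro x t
    obtain ⟨c, hc⟩ := hconst t
    have h1 := hc x
    have h2 := hc 0
    rw [zero_add] at h2
    simp only [f]
    linear_combination h1 - h2
  obtain ⟨x₀, hx₀⟩ : ∃ x, f x ≠ 0 := by
    by_contra! h
    refine he0 ((Submodule.Quotient.mk_eq_zero C).2 ((hC e).2 ⟨e 0, fun x => ?_⟩))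
    exact sub_eq_zero.1 (h x)
  have hχ0 : χ 0 = 1 := by
    have := hf x₀ 0
    rw [add_zero, hf0, add_zero] at this
    exact (mul_right_cancel₀ hx₀ (by rw [one_mul]; exact this)).symm
  have hχadd : ∀ s t, χ (s + t) = χ s * χ t := by
    intro s t
    have h1 := hf x₀ (s + t)
    rw [← add_assoc, hf (x₀ + s) t, hf x₀ s, hf s t] at h1
    refine mul_right_cancel₀ hx₀ ?_
    linear_combination -h1
  have hsymm : ∀ s t, (χ t - 1) * f s = (χ s - 1) * f t := by
    intro s t
    have h1 := hf s t
    rw [add_comm, hf t s] at h1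
    linear_combination -h1
  by_cases htriv : ∀ x, χ x = 1
  · have := additive_eq_zero_of_mem W hscal σ hσ hσW f (fun x t => by rw [hf, htriv, one_mul]) hfW
    exact hx₀ (congrFun this x₀)
  · push Not at htriv
    obtain ⟨t, ht⟩ := htriv
    have ht' : χ t - 1 ≠ 0 := sub_ne_zero.2 ht
    have hft : f t ≠ 0 := by
      intro h0
      have := hsymm x₀ t
      rw [h0, mul_zero] at this
      exact (mul_ne_zero ht' hx₀) this
    refine ht (character_eq_one_of_mem W hscal χ hχ0 hχadd ?_ t)
    have : χ = ((χ t - 1) / f t) • f + (fun _ => 1) := by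
      funext s
      have := hsymm s t
      simp only [Pi.add_apply, Pi.smul_apply, smul_eq_mul]
      field_simp
      linear_combination -this
    rw [this]
    exact W.add_mem (W.smul_mem _ hfW) hone

end InvariantFunctions

section CremonaElements

variable {k : Type u} [Field k]

/-- The field `k(x)` inside `k(x, y)`. -/
abbrev baseField (k : Type u) [Field k] : IntermediateField k (CremonaField k) := k⟮coord k 0⟯

theorem coord_zero_mem_baseField : coord k 0 ∈ baseField k := mem_adjoin_simple_self k _

theorem exists_cremona {x y : CremonaField k} (h : k⟮x, y⟯ = ⊤) :
    ∃ g : CremonaK k, g (coord k 0) = x ∧ g (coord k 1) = y :=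
  exists_algEquiv_of_adjoin_eq_top h (two_le_trdeg_cremonaField k)

theorem adjoin_eq_top_of_mem {x y : CremonaField k} (h0 : coord k 0 ∈ k⟮x, y⟯)
    (h1 : coord k 1 ∈ k⟮x, y⟯) : k⟮x, y⟯ = ⊤ := by
  rw [eq_top_iff, ← adjoin_coord_eq_top k, adjoin_le_iff]
  rintro z (rfl | rfl)
  · exact h0
  · exact h1

theorem baseField_le_adjoin (y : CremonaField k) : baseField k ≤ k⟮coord k 0, y⟯ :=
  adjoin_simple_le_iff.2 (subset_adjoin _ _ (Or.inl rfl))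

theorem adjoin_map_eq_top (g : CremonaK k) : k⟮g (coord k 0), g (coord k 1)⟯ = ⊤ := by
  have h := congrArg (IntermediateField.map (g : CremonaField k →ₐ[k] CremonaField k))
    (adjoin_coord_eq_top k)
  rw [adjoin_map, Set.image_pair, ← AlgHom.fieldRange_eq_map,
    AlgHom.fieldRange_eq_top.2 g.surjective] at h
  exact h

theorem eqOn_adjoin {F E : Type*} [Field F] [Field E] [Algebra k F] [Algebra k E] {f g : F →ₐ[k] E}
    {s : Set F} (h : Set.EqOn f g s) : ∀ z ∈ adjoin k s, f z = g z := by
  intro z hz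
  induction hz using adjoin_induction with
  | mem x hx => exact h hx
  | algebraMap x => rw [AlgHom.commutes, AlgHom.commutes]
  | add x y _ _ hx hy => rw [map_add, map_add, hx, hy]
  | inv x _ hx => rw [map_inv₀, map_inv₀, hx]
  | mul x y _ _ hx hy => rw [map_mul, map_mul, hx, hy]

theorem CremonaK.ext_coord {g g' : CremonaK k} (h0 : g (coord k 0) = g' (coord k 0))
    (h1 : g (coord k 1) = g' (coord k 1)) : g = g' := by
  refine AlgEquiv.ext fun z => ?_
  refine eqOn_adjoin (f := (g : CremonaField k →ₐ[k] CremonaField k))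
    (g := (g' : CremonaField k →ₐ[k] CremonaField k)) (s := {coord k 0, coord k 1}) ?_ z ?_
  · rintro _ (rfl | rfl)
    · exact h0
    · exact h1
  · rw [adjoin_coord_eq_top]; trivial

theorem CremonaK.apply_of_mem {g : CremonaK k} (hg : g (coord k 0) = coord k 0)
    {z : CremonaField k} (hz : z ∈ baseField k) : g z = z := by
  refine eqOn_adjoin (f := (g : CremonaField k →ₐ[k] CremonaField k))
    (g := AlgHom.id k _) (s := {coord k 0}) ?_ z hz
  rintro _ rfl
  exact hg

theorem CremonaK.apply_mem {g : CremonaK k} (hg : g (coord k 0) ∈ baseField k)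
    {z : CremonaField k} (hz : z ∈ baseField k) : g z ∈ baseField k := by
  have : baseField k ≤ (baseField k).comap (g : CremonaField k →ₐ[k] CremonaField k) :=
    adjoin_simple_le_iff.2 hg
  exact this hz

theorem exists_translation {f : CremonaField k} (hf : f ∈ baseField k) :
    ∃ g : CremonaK k, g (coord k 0) = coord k 0 ∧ g (coord k 1) = coord k 1 + f := by
  refine exists_cremona (adjoin_eq_top_of_mem (subset_adjoin _ _ (Or.inl rfl)) ?_)
  have h1 : coord k 1 + f ∈ k⟮coord k 0, coord k 1 + f⟯ := subset_adjoin _ _ (Or.inr rfl)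
  have := sub_mem h1 (baseField_le_adjoin _ hf)
  rwa [add_sub_cancel_right] at this

theorem exists_homothety {h : CremonaField k} (hh : h ∈ baseField k) (h0 : h ≠ 0) :
    ∃ g : CremonaK k, g (coord k 0) = coord k 0 ∧ g (coord k 1) = h * coord k 1 := by
  refine exists_cremona (adjoin_eq_top_of_mem (subset_adjoin _ _ (Or.inl rfl)) ?_)
  have h1 : h * coord k 1 ∈ k⟮coord k 0, h * coord k 1⟯ := subset_adjoin _ _ (Or.inr rfl)
  have := mul_mem (inv_mem (baseField_le_adjoin (h * coord k 1) hh)) h1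
  rwa [inv_mul_cancel_left₀ h0] at this

theorem exists_inversion :
    ∃ g : CremonaK k, g (coord k 0) = coord k 0 ∧ g (coord k 1) = (coord k 1)⁻¹ := by
  refine exists_cremona (adjoin_eq_top_of_mem (subset_adjoin _ _ (Or.inl rfl)) ?_)
  have h1 : (coord k 1)⁻¹ ∈ k⟮coord k 0, (coord k 1)⁻¹⟯ := subset_adjoin _ _ (Or.inr rfl)
  have := inv_mem h1
  rwa [inv_inv] at this

theorem exists_coord_swap :
    ∃ g : CremonaK k, g (coord k 0) = coord k 1 ∧ g (coord k 1) = coord k 0 :=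
  exists_cremona (adjoin_eq_top_of_mem (subset_adjoin _ _ (Or.inr rfl))
    (subset_adjoin _ _ (Or.inl rfl)))

/-- An automorphism of `k(x)` extends to `k(x, y)`. -/
theorem exists_base_change {x : CremonaField k} (hx : coord k 0 ∈ k⟮x⟯) :
    ∃ g : CremonaK k, g (coord k 0) = x ∧ g (coord k 1) = coord k 1 := by
  refine exists_cremona (adjoin_eq_top_of_mem ?_ (subset_adjoin _ _ (Or.inr rfl)))
  exact adjoin.mono k {x} _ (by simp) hx

theorem exists_base_translation (a : k) :
    ∃ g : CremonaK k, g (coord k 0) = coord k 0 + algebraMap k _ a ∧ g (coord k 1) = coord k 1 := by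
  refine exists_base_change ?_
  have := sub_mem (mem_adjoin_simple_self k (coord k 0 + algebraMap k _ a))
    (IntermediateField.algebraMap_mem _ a)
  rwa [add_sub_cancel_right] at this

theorem coord_ne_algebraMap (i : Fin 2) (a : k) : coord k i ≠ algebraMap k _ a := by
  obtain ⟨D₁, D₂, hD, -⟩ := exists_jacobian_valuation k
  have := hD _ _ (adjoin_coord_eq_top k)
  intro h
  fin_cases i <;> simp_all [jacobian]

theorem coord_ne_zero (i : Fin 2) : coord k i ≠ 0 := by
  simpa using coord_ne_algebraMap i (0 : k)

end CremonaElements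

section LinearRepresentation

variable {k : Type u} [Field k] [IsAlgClosed k]

/-- Elementary translations act trivially: the matrix coefficients of the translation subgroup span
a finite-dimensional invariant space of functions. -/
theorem map_translation_eq_one_of_isAlgClosed {K : Type v} [Field K] [IsAlgClosed K] {n : ℕ}
    (φ : CremonaK k →* Matrix.GeneralLinearGroup (Fin n) K) {f : CremonaField k}
    (hf : f ∈ baseField k) {g : CremonaK k} (hg0 : g (coord k 0) = coord k 0)
    (hg1 : g (coord k 1) = coord k 1 + f) : φ g = 1 := by
  choose T hT0 hT1 using fun f : baseField k => exists_translation f.2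
  have hTb : ∀ f : baseField k, ∀ z ∈ baseField k, T f z = z := fun f z hz =>
    CremonaK.apply_of_mem (hT0 f) hz
  let M : baseField k → Matrix (Fin n) (Fin n) K := fun f => (φ (T f)).val
  let Λ : Module.Dual K (Matrix (Fin n) (Fin n) K) →ₗ[K] (baseField k → K) :=
    { toFun := fun l f => l (M f)
      map_add' := fun _ _ => rfl
      map_smul' := fun _ _ => rfl }
  let W : Submodule K (baseField k → K) := LinearMap.range Λ ⊔ K ∙ (fun _ => (1 : K))
  have hfin : FiniteDimensional K W := inferInstance
  have hW : ∀ (θ : baseField k → baseField k) (A B : Matrix (Fin n) (Fin n) K),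
      (∀ f, M (θ f) = A * M f * B) → ∀ w ∈ W, w ∘ θ ∈ W := by
    intro θ A B hθ
    have : W ≤ W.comap (LinearMap.funLeft K K θ) := by
      refine sup_le ?_ ?_
      · rintro _ ⟨l, rfl⟩
        refine Submodule.mem_sup_left ⟨l ∘ₗ LinearMap.mulRight K B ∘ₗ LinearMap.mulLeft K A, ?_⟩
        funext f
        simp [Λ, LinearMap.funLeft_apply, hθ]
      · rw [Submodule.span_singleton_le_iff_mem]
        exact Submodule.mem_sup_right (Submodule.mem_span_singleton_self _)
    exact fun w hw => this hw
  have hinf : Infinite k := IsAlgClosed.instInfinite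
  have hinfL : Infinite (baseField k) :=
    Infinite.of_injective (algebraMap k (baseField k)) (algebraMap k (baseField k)).injective
  choose B hB0 hB1 using fun a : k => exists_base_translation a
  have hBmem : ∀ a, ∀ z ∈ baseField k, B a z ∈ baseField k := fun a z hz =>
    CremonaK.apply_mem (by
      rw [hB0]
      exact add_mem coord_zero_mem_baseField (IntermediateField.algebraMap_mem _ a)) hz
  let σ : k → baseField k →+* baseField k := fun a =>
    (((B a : CremonaField k →+* CremonaField k)).comp
      (algebraMap (baseField k) (CremonaField k))).codRestrict (baseField k)
      fun z => hBmem a z z.2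
  have hσ : Function.Injective σ := by
    intro a b hab
    have := congrArg Subtype.val (DFunLike.congr_fun hab ⟨coord k 0, coord_zero_mem_baseField⟩)
    change B a (coord k 0) = B b (coord k 0) at this
    rw [hB0, hB0] at this
    exact (algebraMap k _).injective (add_left_cancel this)
  have hcoef := apply_eq_apply_of_mem_of_invariant W
    (Submodule.mem_sup_right (Submodule.mem_span_singleton_self _))
    (fun t w hw => by
      refine hW (fun f => f + t) 1 (M t) (fun f => ?_) w hw
      have : T (f + t) = T f * T t := by
        refine CremonaK.ext_coord ?_ ?_
        · rw [AlgEquiv.mul_apply, hT0, hT0, hT0]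
        · rw [AlgEquiv.mul_apply, hT1, hT1, map_add, hT1, hTb _ _ t.2, add_assoc]
          rfl
      simp only [M, this, map_mul, Units.val_mul, one_mul])
    (fun h h0 w hw => by
      obtain ⟨d, hd0, hd1⟩ := exists_homothety h.2 (fun h' => h0 (Subtype.ext h'))
      refine hW (fun f => h * f) (φ d)⁻¹.val (φ d).val (fun f => ?_) w hw
      have : d * T (h * f) = T f * d := by
        refine CremonaK.ext_coord ?_ ?_
        · rw [AlgEquiv.mul_apply, AlgEquiv.mul_apply, hT0, hd0, hT0]
        · rw [AlgEquiv.mul_apply, AlgEquiv.mul_apply, hT1, hd1, map_add, map_mul, hd1,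
            CremonaK.apply_of_mem hd0 (h * f).2, hTb _ _ h.2, hT1, mul_add]
          rfl
      have h2 : T (h * f) = d⁻¹ * T f * d := by rw [mul_assoc, ← this, inv_mul_cancel_left]
      simp only [M, h2, map_mul, map_inv, Units.val_mul])
    σ hσ
    (fun a w hw => by
      refine hW (σ a) (φ (B a)).val (φ (B a))⁻¹.val (fun f => ?_) w hw
      have : T (σ a f) * B a = B a * T f := by
        refine CremonaK.ext_coord ?_ ?_
        · rw [AlgEquiv.mul_apply, AlgEquiv.mul_apply, hT0, hB0, map_add, hT0, AlgEquiv.commutes]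
        · rw [AlgEquiv.mul_apply, AlgEquiv.mul_apply, hT1, hB1, map_add, hB1, hT1]
          rfl
      have h2 : T (σ a f) = B a * T f * (B a)⁻¹ := by rw [← this, mul_inv_cancel_right]
      simp only [M, h2, map_mul, map_inv, Units.val_mul])
  have hg : g = T ⟨f, hf⟩ := CremonaK.ext_coord (by rw [hg0, hT0]) (by rw [hg1, hT1])
  have h0 : T 0 = 1 := CremonaK.ext_coord (by rw [hT0]; rfl) (by rw [hT1]; simp)
  rw [hg]
  refine Units.ext (Matrix.ext fun i j => ?_)
  have := hcoef (Λ (Matrix.entryLinearMap K K i j))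
    (Submodule.mem_sup_left (LinearMap.mem_range_self _ _)) ⟨f, hf⟩ 0
  change (φ (T ⟨f, hf⟩)).val i j = (φ (T 0)).val i j at this
  rw [h0, map_one] at this
  exact this

theorem map_translation_eq_one {K : Type v} [Field K] {n : ℕ}
    (φ : CremonaK k →* Matrix.GeneralLinearGroup (Fin n) K) {f : CremonaField k}
    (hf : f ∈ baseField k) {g : CremonaK k} (hg0 : g (coord k 0) = coord k 0)
    (hg1 : g (coord k 1) = coord k 1 + f) : φ g = 1 := by
  have h := map_translation_eq_one_of_isAlgClosed
    ((Matrix.GeneralLinearGroup.map (algebraMap K (AlgebraicClosure K))).comp φ) hf hg0 hg1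
  refine Units.ext (Matrix.ext fun i j => (algebraMap K (AlgebraicClosure K)).injective ?_)
  have h1 := congrArg (fun A : Matrix.GeneralLinearGroup (Fin n) (AlgebraicClosure K) => A i j) h
  simp only [MonoidHom.comp_apply, Matrix.GeneralLinearGroup.map_apply] at h1
  rw [h1]
  simp [Matrix.one_apply, apply_ite]

end LinearRepresentation

section NormalSubgroup

variable {k : Type u} [Field k]

/-- A subgroup of the Cremona group containing all elementary translations. -/
def ContainsTranslations (N : Subgroup (CremonaK k)) : Prop :=
  ∀ f ∈ baseField k, ∀ g : CremonaK k, g (coord k 0) = coord k 0 →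
    g (coord k 1) = coord k 1 + f → g ∈ N

variable {N : Subgroup (CremonaK k)}

theorem ContainsTranslations.exists_weyl (hN : ContainsTranslations N) (hnorm : N.Normal)
    {h : CremonaField k} (hh : h ∈ baseField k) (h0 : h ≠ 0) :
    ∃ g ∈ N, g (coord k 0) = coord k 0 ∧ g (coord k 1) = -(h ^ 2 * (coord k 1)⁻¹) := by
  obtain ⟨T, hT0, hT1⟩ := exists_translation hh
  obtain ⟨T', hT0', hT1'⟩ := exists_translation (neg_mem (inv_mem hh))
  obtain ⟨I, hI0, hI1⟩ := exists_inversion (k := k)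
  have hI : I⁻¹ = I := by
    refine inv_eq_of_mul_eq_one_left (CremonaK.ext_coord ?_ ?_)
    · rw [AlgEquiv.mul_apply, hI0, hI0]; rfl
    · rw [AlgEquiv.mul_apply, hI1, map_inv₀, hI1, inv_inv]; rfl
  have hTh : T h = h := CremonaK.apply_of_mem hT0 hh
  have hIh : I h = h := CremonaK.apply_of_mem hI0 hh
  have hTN := hN _ hh T hT0 hT1
  have hLN := hnorm.conj_mem T' (hN _ (neg_mem (inv_mem hh)) T' hT0' hT1') I
  rw [hI] at hLN
  refine ⟨T * (I * T' * I) * T, N.mul_mem (N.mul_mem hTN hLN) hTN, ?_, ?_⟩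
  · simp only [AlgEquiv.mul_apply, hT0, hI0, hT0']
  · have hy : coord k 1 ≠ 0 := coord_ne_zero 1
    have hyh : coord k 1 + h ≠ 0 := by
      rw [← hT1]
      exact (map_ne_zero _).2 hy
    have hT'h : T' h = h := CremonaK.apply_of_mem hT0' hh
    simp only [AlgEquiv.mul_apply, hT1, hI1, hT1', map_add, map_inv₀, map_neg, hTh, hIh, hT'h]
    have h2 : (coord k 1 + h)⁻¹ + -h⁻¹ = -(coord k 1 / ((coord k 1 + h) * h)) := by
      field_simp
      ring
    rw [h2, inv_neg, inv_div]
    field_simp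
    ring

theorem ContainsTranslations.homothety_algebraMap_mem [IsAlgClosed k] (hN : ContainsTranslations N)
    (hnorm : N.Normal) {c : k} (hc : c ≠ 0) {g : CremonaK k} (hg0 : g (coord k 0) = coord k 0)
    (hg1 : g (coord k 1) = algebraMap k _ c * coord k 1) : g ∈ N := by
  obtain ⟨d, hd⟩ := IsAlgClosed.exists_pow_nat_eq c (n := 2) two_pos
  have hd0 : d ≠ 0 := by rintro rfl; simp at hd; exact hc hd.symm
  obtain ⟨w, hw, hw0, hw1⟩ := hN.exists_weyl hnorm (one_mem (baseField k)) one_ne_zero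
  obtain ⟨w', hw', hw0', hw1'⟩ := hN.exists_weyl hnorm
    (IntermediateField.algebraMap_mem (baseField k) d) ((map_ne_zero _).2 hd0)
  have : g = w * w' := by
    refine CremonaK.ext_coord ?_ ?_
    · rw [AlgEquiv.mul_apply, hg0, hw0', hw0]
    · rw [AlgEquiv.mul_apply, hg1, hw1', map_neg, map_mul, map_pow, AlgEquiv.commutes, map_inv₀,
        hw1, ← hd, map_pow]
      simp [inv_neg]
  rw [this]
  exact N.mul_mem hw hw'

theorem ContainsTranslations.inversion_mem [IsAlgClosed k] (hN : ContainsTranslations N)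
    (hnorm : N.Normal) {g : CremonaK k} (hg0 : g (coord k 0) = coord k 0)
    (hg1 : g (coord k 1) = (coord k 1)⁻¹) : g ∈ N := by
  obtain ⟨w, hw, hw0, hw1⟩ := hN.exists_weyl hnorm (one_mem (baseField k)) one_ne_zero
  obtain ⟨d, hd0, hd1⟩ := exists_homothety
    (IntermediateField.algebraMap_mem (baseField k) (-1)) (by simp)
  have : g = d * w := by
    refine CremonaK.ext_coord ?_ ?_
    · rw [AlgEquiv.mul_apply, hg0, hw0, hd0]
    · rw [AlgEquiv.mul_apply, hg1, hw1, map_neg, map_mul, map_pow, map_one, map_inv₀, hd1]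
      simp [inv_neg]
  rw [this]
  exact N.mul_mem (hN.homothety_algebraMap_mem hnorm (by simp) hd0 hd1) hw

theorem ContainsTranslations.swap_mem [IsAlgClosed k] (hN : ContainsTranslations N)
    (hnorm : N.Normal) {g : CremonaK k} (hg0 : g (coord k 0) = coord k 1)
    (hg1 : g (coord k 1) = coord k 0) : g ∈ N := by
  have hx : coord k 0 ∈ baseField k := coord_zero_mem_baseField
  obtain ⟨U, hU0, hU1⟩ := exists_translation hx
  obtain ⟨U', hU0', hU1'⟩ := exists_translation (neg_mem hx)
  obtain ⟨d, hd0, hd1⟩ := exists_homothety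
    (IntermediateField.algebraMap_mem (baseField k) (-1)) (by simp)
  have hgg : g⁻¹ = g := by
    refine inv_eq_of_mul_eq_one_left (CremonaK.ext_coord ?_ ?_)
    · rw [AlgEquiv.mul_apply, hg0, hg1]; rfl
    · rw [AlgEquiv.mul_apply, hg1, hg0]; rfl
  have hV := hnorm.conj_mem U' (hN _ (neg_mem hx) U' hU0' hU1') g
  rw [hgg] at hV
  have hUN := hN _ hx U hU0 hU1
  have : g = d * (U * (g * U' * g) * U) := by
    refine CremonaK.ext_coord ?_ ?_
    · simp [AlgEquiv.mul_apply, hg0, hg1, hU0, hU1, hU1', hd1]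
    · simp [AlgEquiv.mul_apply, hg0, hg1, hU0, hU1, hU0', hU1', hd0]
  rw [this]
  exact N.mul_mem (hN.homothety_algebraMap_mem hnorm (by simp) hd0 hd1)
    (N.mul_mem (N.mul_mem hUN hV) hUN)

theorem ContainsTranslations.base_translation_mem [IsAlgClosed k] (hN : ContainsTranslations N)
    (hnorm : N.Normal) {a : k} {g : CremonaK k} (hg0 : g (coord k 0) = coord k 0 + algebraMap k _ a)
    (hg1 : g (coord k 1) = coord k 1) : g ∈ N := by
  have ha := IntermediateField.algebraMap_mem (baseField k) a
  obtain ⟨T, hT0, hT1⟩ := exists_translation ha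
  obtain ⟨s, hs0, hs1⟩ := exists_coord_swap (k := k)
  have hsN := hN.swap_mem hnorm hs0 hs1
  have : g = s * T * s := by
    refine CremonaK.ext_coord ?_ ?_
    · simp [AlgEquiv.mul_apply, hs0, hs1, hT1, hg0]
    · simp [AlgEquiv.mul_apply, hs0, hs1, hT0, hg1]
  rw [this]
  exact N.mul_mem (N.mul_mem hsN (hN _ ha T hT0 hT1)) hsN

/-- The functions whose homotheties belong to a subgroup. -/
def homothetySet (N : Subgroup (CremonaK k)) : Set (CremonaField k) :=
  {h | h ∈ baseField k ∧ h ≠ 0 ∧ ∀ g : CremonaK k, g (coord k 0) = coord k 0 →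
    g (coord k 1) = h * coord k 1 → g ∈ N}

theorem mul_mem_homothetySet {h h' : CremonaField k} (hh : h ∈ homothetySet N)
    (hh' : h' ∈ homothetySet N) : h * h' ∈ homothetySet N := by
  refine ⟨mul_mem hh.1 hh'.1, mul_ne_zero hh.2.1 hh'.2.1, fun g hg0 hg1 => ?_⟩
  obtain ⟨d, hd0, hd1⟩ := exists_homothety hh.1 hh.2.1
  obtain ⟨d', hd0', hd1'⟩ := exists_homothety hh'.1 hh'.2.1
  have : g = d * d' := by
    refine CremonaK.ext_coord ?_ ?_
    · rw [AlgEquiv.mul_apply, hg0, hd0', hd0]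
    · rw [AlgEquiv.mul_apply, hg1, hd1', map_mul, hd1, CremonaK.apply_of_mem hd0 hh'.1]
      ring
  rw [this]
  exact N.mul_mem (hh.2.2 d hd0 hd1) (hh'.2.2 d' hd0' hd1')

theorem inv_mem_homothetySet {h : CremonaField k} (hh : h ∈ homothetySet N) :
    h⁻¹ ∈ homothetySet N := by
  refine ⟨inv_mem hh.1, inv_ne_zero hh.2.1, fun g hg0 hg1 => ?_⟩
  obtain ⟨d, hd0, hd1⟩ := exists_homothety hh.1 hh.2.1
  have : g = d⁻¹ := by
    refine eq_inv_of_mul_eq_one_left (CremonaK.ext_coord ?_ ?_)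
    · rw [AlgEquiv.mul_apply, hd0, hg0]; rfl
    · rw [AlgEquiv.mul_apply, hd1, map_mul, CremonaK.apply_of_mem hg0 hh.1, hg1,
        mul_inv_cancel_left₀ hh.2.1]
      rfl
  rw [this]
  exact N.inv_mem (hh.2.2 d hd0 hd1)

theorem apply_mem_homothetySet (hnorm : N.Normal) {h : CremonaField k} (hh : h ∈ homothetySet N)
    {g : CremonaK k} (hg0 : g (coord k 0) ∈ baseField k) (hg1 : g (coord k 1) = coord k 1) :
    g h ∈ homothetySet N := by
  refine ⟨CremonaK.apply_mem hg0 hh.1, (map_ne_zero _).2 hh.2.1, fun d hd0 hd1 => ?_⟩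
  obtain ⟨e, he0, he1⟩ := exists_homothety hh.1 hh.2.1
  have : d = g * e * g⁻¹ := by
    refine eq_mul_inv_of_mul_eq (CremonaK.ext_coord ?_ ?_)
    · rw [AlgEquiv.mul_apply, AlgEquiv.mul_apply, he0, CremonaK.apply_of_mem hd0 hg0]
    · rw [AlgEquiv.mul_apply, AlgEquiv.mul_apply, he1, map_mul, hg1, hd1]
  rw [this]
  exact hnorm.conj_mem _ (hh.2.2 e he0 he1) g

theorem ContainsTranslations.algebraMap_mem_homothetySet [IsAlgClosed k]
    (hN : ContainsTranslations N) (hnorm : N.Normal) {c : k} (hc : c ≠ 0) :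
    algebraMap k _ c ∈ homothetySet N :=
  ⟨IntermediateField.algebraMap_mem _ c, (map_ne_zero _).2 hc, fun _ hg0 hg1 =>
    hN.homothety_algebraMap_mem hnorm hc hg0 hg1⟩

theorem ContainsTranslations.coord_mem_homothetySet [IsAlgClosed k]
    (hN : ContainsTranslations N) (hnorm : N.Normal) : coord k 0 ∈ homothetySet N := by
  have hx : coord k 0 ∈ baseField k := coord_zero_mem_baseField
  have hx0 : coord k 0 ≠ 0 := coord_ne_zero 0
  have hx1 : coord k 0 + 1 ≠ 0 := by
    intro h
    exact coord_ne_algebraMap 0 (-1 : k) (by rw [map_neg, map_one]; linear_combination h)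
  have hx1' : coord k 0 - 1 ≠ 0 := by
    intro h
    exact coord_ne_algebraMap 0 (1 : k) (by rw [map_one]; linear_combination h)
  have hmem : (coord k 0 + 1) / coord k 0 ∈ homothetySet N := by
    refine ⟨div_mem (add_mem hx (one_mem _)) hx, div_ne_zero hx1 hx0, fun g hg0 hg1 => ?_⟩
    obtain ⟨A, hA0, hA1⟩ := exists_base_translation (1 : k)
    rw [map_one] at hA0
    obtain ⟨d, hd0, hd1⟩ := exists_homothety hx hx0
    have hAN := hN.base_translation_mem hnorm (a := 1) (by rw [hA0, map_one]) hA1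
    have : g = A * (d * A⁻¹ * d⁻¹) := by
      rw [← mul_assoc, ← mul_assoc]
      refine eq_mul_inv_of_mul_eq (eq_mul_inv_of_mul_eq (CremonaK.ext_coord ?_ ?_))
      · rw [AlgEquiv.mul_apply, AlgEquiv.mul_apply, AlgEquiv.mul_apply, hA0, map_add, map_add, hd0,
          hg0, hA0, map_one, map_one]
      · rw [AlgEquiv.mul_apply, AlgEquiv.mul_apply, AlgEquiv.mul_apply, hA1, hd1, map_mul, map_mul,
          hg0, hg1, hA0, hA1]
        field_simp
    rw [this]
    exact N.mul_mem hAN (hnorm.conj_mem _ (N.inv_mem hAN) d)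
  have hbase : coord k 0 ∈ k⟮(coord k 0 - 1)⁻¹⟯ := by
    have h1 := add_mem (inv_mem (mem_adjoin_simple_self k (coord k 0 - 1)⁻¹)) (one_mem _)
    rwa [inv_inv, sub_add_cancel] at h1
  obtain ⟨g, hg0, hg1⟩ := exists_base_change hbase
  have := apply_mem_homothetySet hnorm hmem (g := g)
    (by rw [hg0]; exact inv_mem (sub_mem hx (one_mem _))) hg1
  rw [map_div₀, map_add, map_one, hg0] at this
  convert this using 1
  field_simp
  ring

theorem ContainsTranslations.mem_homothetySet [IsAlgClosed k]
    (hN : ContainsTranslations N) (hnorm : N.Normal) {h : CremonaField k} (hh : h ∈ baseField k)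
    (h0 : h ≠ 0) : h ∈ homothetySet N := by
  have hx : coord k 0 ∈ baseField k := coord_zero_mem_baseField
  have hlin : ∀ a : k, coord k 0 - algebraMap k _ a ∈ homothetySet N := by
    intro a
    obtain ⟨g, hg0, hg1⟩ := exists_base_translation (-a)
    have := apply_mem_homothetySet hnorm (hN.coord_mem_homothetySet hnorm) (g := g)
      (by rw [hg0]; exact add_mem hx (IntermediateField.algebraMap_mem _ _)) hg1
    rwa [hg0, map_neg, ← sub_eq_add_neg] at this
  have hpoly : ∀ p : Polynomial k, p ≠ 0 → Polynomial.aeval (coord k 0) p ∈ homothetySet N := by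
    intro p hp
    have hs := (IsAlgClosed.splits p).eq_prod_roots
    rw [hs, map_mul, Polynomial.aeval_C, map_multiset_prod]
    refine mul_mem_homothetySet
      (hN.algebraMap_mem_homothetySet hnorm (Polynomial.leadingCoeff_ne_zero.2 hp)) ?_
    generalize p.roots = s
    induction s using Multiset.induction_on with
    | empty =>
      simpa using hN.algebraMap_mem_homothetySet hnorm (one_ne_zero (α := k))
    | cons a s ih =>
      rw [Multiset.map_cons, Multiset.map_cons, Multiset.prod_cons]
      refine mul_mem_homothetySet ?_ ih
      simpa using hlin a
  obtain ⟨r, s, rfl⟩ := (mem_adjoin_simple_iff k h).1 hh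
  have hr : r ≠ 0 := by rintro rfl; simp at h0
  have hs : s ≠ 0 := by rintro rfl; simp at h0
  rw [div_eq_mul_inv]
  exact mul_mem_homothetySet (hpoly r hr) (inv_mem_homothetySet (hpoly s hs))

end NormalSubgroup

section Mobius

open Polynomial

/-- A generator of a simple transcendental extension is a Möbius transform of any other one. -/
theorem exists_mobius {L E : Type*} [Field L] [Field E] [Algebra L E] {y z : E}
    (hy : Transcendental L y) (hy' : L⟮y⟯ = ⊤) (hz : L⟮z⟯ = ⊤) :
    ∃ a b c d : L, algebraMap L E c * y + algebraMap L E d ≠ 0 ∧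
      z = (algebraMap L E a * y + algebraMap L E b) / (algebraMap L E c * y + algebraMap L E d) := by
  let e : RatFunc L ≃ₐ[L] E :=
    (RatFunc.algEquivOfTranscendental y hy).trans ((equivOfEq hy').trans topEquiv)
  have he : ∀ w, e w = aeval y w.num / aeval y w.denom :=
    fun w => RatFunc.algEquivOfTranscendental_apply y hy w
  obtain ⟨u, rfl⟩ := e.surjective z
  have hu : L⟮u⟯ = ⊤ := by
    have h := congrArg (IntermediateField.map (e.symm : E →ₐ[L] RatFunc L)) hz
    rw [adjoin_map, Set.image_singleton, ← AlgHom.fieldRange_eq_map,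
      AlgHom.fieldRange_eq_top.2 e.symm.surjective] at h
    simpa using h
  have hdeg := RatFunc.finrank_eq_max_natDegree u
  rw [hu, IntermediateField.finrank_top] at hdeg
  obtain ⟨a, b, hab⟩ := exists_eq_X_add_C_of_natDegree_le_one
    (hdeg ▸ le_max_left u.num.natDegree u.denom.natDegree)
  obtain ⟨c, d, hcd⟩ := exists_eq_X_add_C_of_natDegree_le_one
    (hdeg ▸ le_max_right u.num.natDegree u.denom.natDegree)
  have hden : aeval y u.denom ≠ 0 := fun h => hy ⟨_, u.denom_ne_zero, h⟩
  refine ⟨a, b, c, d, ?_, ?_⟩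
  · simpa [hcd] using hden
  · rw [he, hab, hcd]
    simp

end Mobius

section Kernel

variable {k : Type u} [Field k]

open algebraAdjoinAdjoin in
theorem transcendental_coord_one : Transcendental (baseField k) (coord k 1) := by
  have hb := (isTranscendenceBasis_of_adjoin_eq_top (adjoin_coord_eq_top k)
    (two_le_trdeg_cremonaField k)).1
  have h := hb.transcendental_adjoin (s := {0}) (i := 1) (by simp)
  rw [show Set.image ![coord k 0, coord k 1] {0} = {coord k 0} from Set.image_singleton] at h
  intro h'
  exact h ((IsFractionRing.isAlgebraic_iff (Algebra.adjoin k {coord k 0}) (baseField k)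
    (CremonaField k)).2 h')

theorem baseField_adjoin_eq_top {y : CremonaField k} (h : k⟮coord k 0, y⟯ = ⊤) :
    (baseField k)⟮y⟯ = ⊤ := by
  refine restrictScalars_injective k ?_
  rw [adjoin_adjoin_left, restrictScalars_top, ← h]
  rfl

theorem CremonaK.apply_coord_one_notMem {g : CremonaK k} (hg0 : g (coord k 0) = coord k 0) :
    g (coord k 1) ∉ baseField k := by
  intro h
  have h1 : g (coord k 1) = coord k 1 := g.injective (CremonaK.apply_of_mem hg0 h)
  rw [h1] at h
  have h2 : IsAlgebraic (baseField k) (algebraMap (baseField k) (CremonaField k) ⟨coord k 1, h⟩) :=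
    isAlgebraic_algebraMap _
  rw [IntermediateField.algebraMap_apply] at h2
  exact transcendental_coord_one h2

theorem ContainsTranslations.mem_of_fix [IsAlgClosed k] {N : Subgroup (CremonaK k)}
    (hN : ContainsTranslations N) (hnorm : N.Normal) {g : CremonaK k}
    (hg0 : g (coord k 0) = coord k 0) : g ∈ N := by
  have htop := adjoin_map_eq_top g
  rw [hg0] at htop
  have htop₁ : (baseField k)⟮g (coord k 1)⟯ = ⊤ := baseField_adjoin_eq_top htop
  have htop₂ : (baseField k)⟮coord k 1⟯ = ⊤ := baseField_adjoin_eq_top (adjoin_coord_eq_top k)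
  obtain ⟨⟨a, ha⟩, ⟨b, hb⟩, ⟨c, hc⟩, ⟨d, hd⟩, hden, hg1⟩ :=
    exists_mobius (L := baseField k) (E := CremonaField k) transcendental_coord_one htop₂ htop₁
  simp only [IntermediateField.algebraMap_apply] at hden hg1
  have hnot := CremonaK.apply_coord_one_notMem hg0
  by_cases hc0 : c = 0
  · subst hc0
    simp only [zero_mul, zero_add] at hden hg1
    have ha0 : a ≠ 0 := by
      rintro rfl
      exact hnot (by rw [hg1]; simpa using div_mem hb hd)
    have had := div_mem ha hd
    have had0 := div_ne_zero ha0 hden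
    obtain ⟨D, hD0, hD1⟩ := exists_homothety had had0
    have hbd := div_mem hb hd
    obtain ⟨T, hT0, hT1⟩ := exists_translation hbd
    have : g = D * T := by
      refine CremonaK.ext_coord ?_ ?_
      · rw [AlgEquiv.mul_apply, hg0, hT0, hD0]
      · rw [AlgEquiv.mul_apply, hT1, map_add, hD1, CremonaK.apply_of_mem hD0 hbd, hg1]
        ring
    rw [this]
    exact N.mul_mem ((hN.mem_homothetySet hnorm had had0).2.2 D hD0 hD1) (hN _ hbd T hT0 hT1)
  · have he : g (coord k 1) = (b / c - a / c * (d / c)) / (coord k 1 + d / c) + a / c := by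
      have hden' : coord k 1 + d / c ≠ 0 := by
        intro h
        apply hden
        field_simp at h
        linear_combination h
      rw [hg1, div_add' _ _ _ hden', div_eq_div_iff hden hden']
      field_simp
      ring
    have hdc := div_mem hd hc
    have hac := div_mem ha hc
    have hm := sub_mem (div_mem hb hc) (mul_mem hac hdc)
    generalize d / c = q at he hdc hm
    generalize a / c = p at he hac hm
    generalize b / c - p * q = m at he hm
    have hm0 : m ≠ 0 := by
      rintro rfl
      exact hnot (by rw [he, zero_div, zero_add]; exact hac)
    obtain ⟨T, hT0, hT1⟩ := exists_translation hdc
    obtain ⟨I, hI0, hI1⟩ := exists_inversion (k := k)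
    obtain ⟨D, hD0, hD1⟩ := exists_homothety hm hm0
    obtain ⟨T', hT0', hT1'⟩ := exists_translation hac
    have : g = T * I * D * T' := by
      refine CremonaK.ext_coord ?_ ?_
      · simp only [AlgEquiv.mul_apply, hT0, hI0, hD0, hT0', hg0]
      · simp only [AlgEquiv.mul_apply, hT1', map_add, hD1, CremonaK.apply_of_mem hD0 hac,
          CremonaK.apply_of_mem hI0 hac, CremonaK.apply_of_mem hT0 hac, map_mul,
          CremonaK.apply_of_mem hI0 hm, CremonaK.apply_of_mem hT0 hm, hI1, map_inv₀, hT1, he,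
          div_eq_mul_inv]
    rw [this]
    exact N.mul_mem (N.mul_mem (N.mul_mem (hN _ hdc T hT0 hT1) (hN.inversion_mem hnorm hI0 hI1))
      ((hN.mem_homothetySet hnorm hm hm0).2.2 D hD0 hD1)) (hN _ hac T' hT0' hT1')

theorem ContainsTranslations.inv_mul_mem_of_left [IsAlgClosed k] {N : Subgroup (CremonaK k)}
    (hN : ContainsTranslations N) (hnorm : N.Normal) {g g' : CremonaK k}
    (h : g (coord k 0) = g' (coord k 0)) : g⁻¹ * g' ∈ N := by
  refine hN.mem_of_fix hnorm ?_
  rw [AlgEquiv.mul_apply, ← h]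
  exact g.symm_apply_apply _

/-- A normal subgroup of the Cremona group containing the elementary translations is everything. -/
theorem ContainsTranslations.mem [IsAlgClosed k] {N : Subgroup (CremonaK k)}
    (hN : ContainsTranslations N) (hnorm : N.Normal) (f : CremonaK k) : f ∈ N := by
  obtain ⟨s, hs0, hs1⟩ := exists_coord_swap (k := k)
  have hs := hN.swap_mem hnorm hs0 hs1
  have hS : IsGeneratorClass k fun x y : CremonaField k =>
      ∃ g : CremonaK k, g (coord k 0) = x ∧ g (coord k 1) = y ∧ f⁻¹ * g ∈ N := by
    refine ⟨?_, ?_, ?_⟩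
    · rintro _ _ ⟨g, rfl, rfl, -⟩
      exact adjoin_map_eq_top g
    · rintro _ _ ⟨g, rfl, rfl, hg⟩
      refine ⟨g * s, by rw [AlgEquiv.mul_apply, hs0], by rw [AlgEquiv.mul_apply, hs1], ?_⟩
      rw [← mul_assoc]
      exact N.mul_mem hg hs
    · rintro _ _ y' ⟨g, rfl, rfl, hg⟩ htop
      obtain ⟨g', hg0', hg1'⟩ := exists_cremona htop
      refine ⟨g', hg0', hg1', ?_⟩
      have := N.mul_mem hg (hN.inv_mul_mem_of_left hnorm hg0'.symm)
      rwa [mul_assoc, mul_inv_cancel_left] at this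
  obtain ⟨_, _, ⟨g, rfl, rfl, hg⟩, hx⟩ := exists_coord_mem_adjoin k hS
    ⟨f, rfl, rfl, by rw [inv_mul_cancel]; exact N.one_mem⟩
  obtain ⟨g', hg0', hg1'⟩ := exists_base_change hx
  have h1 := hN.inv_mul_mem_of_left hnorm hg0'.symm
  have h2 : (g' * s)⁻¹ * s ∈ N := hN.inv_mul_mem_of_left hnorm (by
    rw [AlgEquiv.mul_apply, hs0, hg1'])
  have hg' : g' ∈ N := by
    have h3 := N.mul_mem hs (N.mul_mem h2 (N.inv_mem hs))
    rw [← N.inv_mem_iff]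
    convert h3 using 1
    group
  have h4 := N.mul_mem (N.mul_mem hg h1) (N.inv_mem hg')
  rw [← N.inv_mem_iff]
  convert h4 using 1
  group

end Kernel

end CremonaSubgroups

/-- The plane Cremona group over an algebraically closed field `k` has no non-trivial
finite-dimensional linear representation over any field: every group homomorphism
`Bir(ℙ²_k) → GL(n,K)` is trivial (for `n ≥ 1` and any field `K`). In particular it has
no faithful finite-dimensional linear representation. -/
theorem cremona_no_linear_representation (k : Type u) [Field k] [IsAlgClosed k]
    (K : Type v) [Field K] (n : ℕ) (hn : 1 ≤ n)
    (φ : CremonaK k →* Matrix.GeneralLinearGroup (Fin n) K) :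
    ∀ g : CremonaK k, φ g = 1 := by
  intro g
  exact ContainsTranslations.mem (N := φ.ker)
    (fun _ hf _ hg0 hg1 => map_translation_eq_one φ hf hg0 hg1) φ.normal_ker g
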